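/- arXiv:1505.00767 — 7 statements merged into one kernel-verified Lean document; each statement's English description precedes it below -/
import Mathlib

section
/- Let α > 0 and ξ > 4 be real numbers. There exists N₀ = N₀(α, ξ) such that for all n ≥ N₀ the following holds: if G is a finite simple graph on n vertices with minimum degree δ(G) ≥ (1+α)·log₂ n and Cheeger constant Φ(G) > ξ·(log₂ log₂ n)/(log₂ n), then a uniformly random orientation of G is strongly connected with probability at least 1 − (1 + 4α·log₂ n)/(α·n^α·log₂ n). -/
open Finset

variable {n : ℕ}

/-- `f e = true` means the edge `e` is directed from its smaller endpoint to its
larger endpoint. `dirAdj G f u v` says the orientation `f` directs an edge from `u` to `v`. -/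
def dirAdj (G : SimpleGraph (Fin n)) (f : G.edgeSet → Bool) (u v : Fin n) : Prop :=
  ∃ h : G.Adj u v, f ⟨s(u, v), (SimpleGraph.mem_edgeSet G).mpr h⟩ = decide (u < v)

/-- The oriented graph is strongly connected: every ordered pair of vertices is
joined by a directed path. -/
def IsStronglyConnected (G : SimpleGraph (Fin n)) (f : G.edgeSet → Bool) : Prop :=
  ∀ u v : Fin n, Relation.ReflTransGen (dirAdj G f) u v

/-- Probability of an event under a uniformly random orientation of `G`. -/
noncomputable def orientProb (G : SimpleGraph (Fin n)) [DecidableRel G.Adj]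
    (P : (G.edgeSet → Bool) → Prop) : ℝ :=
  ((@Finset.filter _ P (Classical.decPred _) Finset.univ).card : ℝ) /
    (Fintype.card (G.edgeSet → Bool) : ℝ)

/-- The volume of a vertex subset: the sum of the degrees of its vertices. -/
def vol (G : SimpleGraph (Fin n)) [DecidableRel G.Adj] (X : Finset (Fin n)) : ℕ :=
  ∑ v ∈ X, G.degree v

/-- `e(X, X̄)`: the number of edges of `G` with exactly one endpoint in `X`. -/
def crossCount (G : SimpleGraph (Fin n)) [DecidableRel G.Adj] (X : Finset (Fin n)) : ℕ :=
  ((X ×ˢ Xᶜ).filter fun p => G.Adj p.1 p.2).card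

/-- The edges of `G` with exactly one endpoint in `X`. -/
noncomputable def cutEdges (G : SimpleGraph (Fin n)) [DecidableRel G.Adj] (X : Finset (Fin n)) :
    Finset G.edgeSet :=
  open Classical in univ.filter fun e => ∃ a ∈ X, ∃ b ∉ X, e.1 = s(a, b)

/-- No arc of the orientation `f` leaves `X`. -/
def IsOutClosed (G : SimpleGraph (Fin n)) (f : G.edgeSet → Bool) (X : Finset (Fin n)) : Prop :=
  ∀ a ∈ X, ∀ b ∉ X, ¬ dirAdj G f a b

/-- `T` is the edge set of a tree in `G` grown from the root `v` with vertex set `X`. -/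
inductive IsGrownTree (G : SimpleGraph (Fin n)) (v : Fin n) :
    Finset (Fin n) → Finset (Sym2 (Fin n)) → Prop
  | root : IsGrownTree G v {v} ∅
  | grow {X : Finset (Fin n)} {T : Finset (Sym2 (Fin n))} {a b : Fin n}
      (h : IsGrownTree G v X T) (ha : a ∈ X) (hb : b ∉ X) (hab : G.Adj a b) :
      IsGrownTree G v (insert b X) (insert s(a, b) T)

theorem IsGrownTree.root_mem {G : SimpleGraph (Fin n)} {v : Fin n} {X : Finset (Fin n)}
    {T : Finset (Sym2 (Fin n))} (h : IsGrownTree G v X T) : v ∈ X := by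
  induction h with
  | root => simp
  | grow _ _ _ _ ih => exact mem_insert_of_mem ih

theorem IsGrownTree.card_le {G : SimpleGraph (Fin n)} {v : Fin n} {X : Finset (Fin n)}
    {T : Finset (Sym2 (Fin n))} (h : IsGrownTree G v X T) : T.card ≤ X.card := by
  induction h with
  | root => simp
  | grow _ _ hb _ ih =>
    rw [card_insert_of_notMem hb]
    exact (card_insert_le _ _).trans (by lia)

theorem IsGrownTree.mem_of_mem_edge {G : SimpleGraph (Fin n)} {v : Fin n} {X : Finset (Fin n)}
    {T : Finset (Sym2 (Fin n))} (h : IsGrownTree G v X T) :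
    ∀ e ∈ T, ∀ x ∈ e, x ∈ X := by
  induction h with
  | root => simp
  | grow _ ha _ _ ih =>
    intro e he x hx
    rcases mem_insert.1 he with rfl | he
    · rcases Sym2.mem_iff.1 hx with rfl | rfl
      · exact mem_insert_of_mem ha
      · exact mem_insert_self _ _
    · exact mem_insert_of_mem (ih e he x hx)

theorem exists_isGrownTree_of_mem (G : SimpleGraph (Fin n)) {v : Fin n} {Y : Finset (Fin n)}
    (hv : v ∈ Y) :
    ∃ X T, IsGrownTree G v X T ∧ X ⊆ Y ∧ ∀ a ∈ X, ∀ b ∈ Y, b ∉ X → ¬ G.Adj a b := by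
  classical
  obtain ⟨X, hX, hmax⟩ := exists_max_image
    (univ.filter fun X : Finset (Fin n) => X ⊆ Y ∧ ∃ T, IsGrownTree G v X T) card
    ⟨{v}, by simpa [hv] using ⟨_, IsGrownTree.root⟩⟩
  simp only [mem_filter, mem_univ, true_and] at hX hmax
  obtain ⟨hXY, T, hT⟩ := hX
  refine ⟨X, T, hT, hXY, fun a ha b hbY hb hab => ?_⟩
  have := hmax (insert b X) ⟨insert_subset hbY hXY, _, hT.grow ha hb hab⟩
  rw [card_insert_of_notMem hb] at this
  lia

theorem card_cutEdges (G : SimpleGraph (Fin n)) [DecidableRel G.Adj] (X : Finset (Fin n)) :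
    (cutEdges G X).card = crossCount G X := by
  classical
  symm
  refine card_bij (fun p hp => ⟨s(p.1, p.2), (SimpleGraph.mem_edgeSet G).2 (mem_filter.1 hp).2⟩)
    ?_ ?_ ?_
  · rintro ⟨a, b⟩ hp
    simp only [mem_filter, mem_product, mem_compl] at hp
    simp only [cutEdges, mem_filter, mem_univ, true_and]
    exact ⟨a, hp.1.1, b, hp.1.2, rfl⟩
  · rintro ⟨a, b⟩ hp ⟨c, d⟩ hq h
    simp only [mem_filter, mem_product, mem_compl] at hp hq
    simp only [Subtype.mk.injEq, Sym2.eq_iff] at h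
    rcases h with ⟨rfl, rfl⟩ | ⟨rfl, rfl⟩
    · rfl
    · exact absurd hp.1.1 hq.1.2
  · rintro ⟨e, he⟩ h
    simp only [cutEdges, mem_filter, mem_univ, true_and] at h
    obtain ⟨a, ha, b, hb, rfl⟩ := h
    exact ⟨(a, b), by simpa [ha, hb] using he, rfl⟩

theorem crossCount_compl (G : SimpleGraph (Fin n)) [DecidableRel G.Adj] (X : Finset (Fin n)) :
    crossCount G Xᶜ = crossCount G X := by
  refine card_bij (fun p _ => p.swap) ?_ ?_ ?_
  · rintro ⟨a, b⟩ h
    simp only [mem_filter, mem_product, mem_compl, not_not, Prod.swap] at h ⊢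
    exact ⟨⟨h.1.2, h.1.1⟩, h.2.symm⟩
  · intro p _ q _ h
    exact Prod.swap_injective h
  · rintro ⟨a, b⟩ h
    simp only [mem_filter, mem_product, mem_compl] at h
    exact ⟨(b, a), by simpa [h.1.1, h.1.2] using h.2.symm, rfl⟩

/-- The proportion of functions into `β` with prescribed sets of allowed values. -/
theorem card_piFinset_div_card {ι β : Type*} [Fintype ι] [DecidableEq ι] [Fintype β]
    (t : ι → Finset β) :
    ((Fintype.piFinset t).card : ℝ) / Fintype.card (ι → β) =
      ∏ i, ((t i).card : ℝ) / Fintype.card β := by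
  rw [Fintype.card_piFinset, Fintype.card_fun, prod_div_distrib]
  simp

theorem orientProb_isOutClosed_le (G : SimpleGraph (Fin n)) [DecidableRel G.Adj]
    (X : Finset (Fin n)) :
    orientProb G (fun f => IsOutClosed G f X) ≤ (1 / 2) ^ crossCount G X := by
  classical
  by_cases hf : ∃ f₀, IsOutClosed G f₀ X
  · obtain ⟨f₀, hf₀⟩ := hf
    set t : G.edgeSet → Finset Bool := fun e => if e ∈ cutEdges G X then {f₀ e} else univ with ht
    have hsub : @Finset.filter _ (fun f => IsOutClosed G f X) (Classical.decPred _) univ ⊆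
        Fintype.piFinset t := by
      intro f hf
      have hf : IsOutClosed G f X := (mem_filter.1 hf).2
      refine Fintype.mem_piFinset.2 fun e => ?_
      by_cases he : e ∈ cutEdges G X
      · simp only [ht, he, if_true, mem_singleton]
        obtain ⟨e, hadj⟩ := e
        simp only [cutEdges, mem_filter, mem_univ, true_and] at he
        obtain ⟨a, ha, b, hb, rfl⟩ := he
        have h₁ : f ⟨s(a, b), hadj⟩ ≠ decide (a < b) := fun h =>
          hf a ha b hb ⟨(SimpleGraph.mem_edgeSet G).1 hadj, h⟩
        have h₂ : f₀ ⟨s(a, b), hadj⟩ ≠ decide (a < b) := fun h =>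
          hf₀ a ha b hb ⟨(SimpleGraph.mem_edgeSet G).1 hadj, h⟩
        rw [Bool.eq_not_of_ne h₁, Bool.eq_not_of_ne h₂]
      · simp [ht, he]
    calc orientProb G (fun f => IsOutClosed G f X)
        ≤ ((Fintype.piFinset t).card : ℝ) / Fintype.card (G.edgeSet → Bool) := by
          unfold orientProb
          gcongr
      _ = ∏ e, if e ∈ cutEdges G X then (1 / 2 : ℝ) else 1 := by
          rw [card_piFinset_div_card]
          refine prod_congr rfl fun e _ => ?_
          by_cases he : e ∈ cutEdges G X <;> simp [ht, he]
      _ = (1 / 2) ^ crossCount G X := by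
          rw [prod_ite_mem, univ_inter, prod_const, card_cutEdges]
  · push Not at hf
    have : orientProb G (fun f => IsOutClosed G f X) = 0 := by
      simp [orientProb, hf]
    rw [this]
    positivity

/-- The disjoint events that the cluster of `v` in bond percolation is `X` have total mass at
most one. -/
theorem sum_grownTree_le_one (G : SimpleGraph (Fin n)) [DecidableRel G.Adj] (v : Fin n)
    (F : Finset (Finset (Fin n))) (hF : ∀ X ∈ F, ∃ T, IsGrownTree G v X T) :
    ∑ X ∈ F, (1 / 4 : ℝ) ^ X.card * (3 / 4) ^ crossCount G X ≤ 1 := by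
  classical
  choose! T hT using hF
  set t : Finset (Fin n) → G.edgeSet → Finset (Fin 4) := fun X e =>
    if e.1 ∈ T X then {0} else if e ∈ cutEdges G X then {0}ᶜ else univ with ht
  have hzero : ∀ X, ∀ ω ∈ Fintype.piFinset (t X), ∀ e : G.edgeSet, e.1 ∈ T X → ω e = 0 := by
    intro X ω hω e he
    have := Fintype.mem_piFinset.1 hω e
    simpa [ht, he] using this
  have hdisj : ∀ X ∈ F, ∀ e ∈ cutEdges G X, e.1 ∉ T X := by
    intro X hX e he heT
    simp only [cutEdges, mem_filter, mem_univ, true_and] at he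
    obtain ⟨a, -, b, hb, h⟩ := he
    exact hb ((hT X hX).mem_of_mem_edge _ heT b (by simp [h]))
  have hne : ∀ X ∈ F, ∀ ω ∈ Fintype.piFinset (t X), ∀ e ∈ cutEdges G X, ω e ≠ 0 := by
    intro X hX ω hω e he
    have := Fintype.mem_piFinset.1 hω e
    simpa [ht, he, hdisj X hX e he] using this
  have hsub : ∀ X ∈ F, ∀ (ω : G.edgeSet → Fin 4), ω ∈ Fintype.piFinset (t X) →
      ∀ Z S, IsGrownTree G v Z S → (∀ e : G.edgeSet, e.1 ∈ S → ω e = 0) → Z ⊆ X := by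
    intro X hX ω hω Z S hZ
    induction hZ with
    | root => exact fun _ => singleton_subset_iff.2 (hT X hX).root_mem
    | @grow Z S a b h ha hb hab ih =>
      intro hS
      have hZX := ih fun e he => hS e (mem_insert_of_mem he)
      refine insert_subset (by_contra fun hbX => ?_) hZX
      refine hne X hX ω hω ⟨s(a, b), (SimpleGraph.mem_edgeSet G).2 hab⟩ ?_
        (hS _ (mem_insert_self _ _))
      simp only [cutEdges, mem_filter, mem_univ, true_and]
      exact ⟨a, hZX ha, b, hbX, rfl⟩
  have hpd : (F : Set (Finset (Fin n))).PairwiseDisjoint fun X => Fintype.piFinset (t X) := by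
    intro X hX Z hZ hXZ
    refine disjoint_left.2 fun ω hω hω' => hXZ ?_
    exact (hsub Z hZ ω hω' X _ (hT X hX) (hzero X ω hω)).antisymm
      (hsub X hX ω hω Z _ (hT Z hZ) (hzero Z ω hω'))
  have hterm : ∀ X ∈ F, (1 / 4 : ℝ) ^ X.card * (3 / 4) ^ crossCount G X ≤
      ((Fintype.piFinset (t X)).card : ℝ) / Fintype.card (G.edgeSet → Fin 4) := by
    intro X hX
    rw [card_piFinset_div_card]
    set T' : Finset G.edgeSet := univ.filter fun e => e.1 ∈ T X with hT'
    have hcard : T'.card ≤ X.card :=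
      (card_le_card_of_injOn Subtype.val (fun e he => by simpa [hT'] using he)
        Subtype.val_injective.injOn).trans (hT X hX).card_le
    calc (1 / 4 : ℝ) ^ X.card * (3 / 4) ^ crossCount G X
        ≤ (1 / 4) ^ T'.card * (3 / 4) ^ (cutEdges G X).card := by
          rw [card_cutEdges]
          gcongr ?_ * _
          exact pow_le_pow_of_le_one (by norm_num) (by norm_num) hcard
      _ = ∏ e, ((if e ∈ T' then (1 / 4 : ℝ) else 1) *
            (if e ∈ cutEdges G X then (3 / 4 : ℝ) else 1)) := by
          rw [prod_mul_distrib, prod_ite_mem, prod_ite_mem, univ_inter, univ_inter, prod_const,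
            prod_const]
      _ = _ := by
          refine prod_congr rfl fun e _ => ?_
          by_cases he : e ∈ cutEdges G X
          · simp [ht, hT', he, hdisj X hX e he, card_compl]
          · by_cases heT : e.1 ∈ T X <;> simp [ht, hT', he, heT]
  calc _ ≤ ∑ X ∈ F, ((Fintype.piFinset (t X)).card : ℝ) / Fintype.card (G.edgeSet → Fin 4) :=
        sum_le_sum hterm
    _ = ((F.biUnion fun X => Fintype.piFinset (t X)).card : ℝ) /
          Fintype.card (G.edgeSet → Fin 4) := by
        rw [← sum_div, card_biUnion hpd]
        push_cast
        rfl
    _ ≤ 1 := div_le_one_of_le₀ (by exact_mod_cast card_le_univ _) (by positivity)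

theorem vol_mono (G : SimpleGraph (Fin n)) [DecidableRel G.Adj] {X Y : Finset (Fin n)}
    (h : X ⊆ Y) : vol G X ≤ vol G Y :=
  sum_le_sum_of_subset h

theorem exists_grownTree_of_not_isStronglyConnected (G : SimpleGraph (Fin n)) [DecidableRel G.Adj]
    {f : G.edgeSet → Bool} (hf : ¬ IsStronglyConnected G f) :
    ∃ X, X ≠ univ ∧ vol G X ≤ vol G Xᶜ ∧ (∃ v T, IsGrownTree G v X T) ∧
      (IsOutClosed G f X ∨ IsOutClosed G f Xᶜ) := by
  classical
  simp only [IsStronglyConnected, not_forall] at hf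
  obtain ⟨u, w, huw⟩ := hf
  set S : Finset (Fin n) := univ.filter fun x => Relation.ReflTransGen (dirAdj G f) u x with hS
  have hSout : IsOutClosed G f S := by
    intro a ha b hb hab
    simp only [hS, mem_filter, mem_univ, true_and] at ha hb
    exact hb (ha.tail hab)
  have hu : u ∈ S := by simp [hS, Relation.ReflTransGen.refl]
  have hw : w ∉ S := by simpa [hS] using huw
  obtain ⟨Y, ⟨v, hv⟩, ⟨w', hw'⟩, hvol, hY⟩ : ∃ Y : Finset (Fin n), (∃ v, v ∈ Y) ∧ (∃ w, w ∉ Y) ∧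
      vol G Y ≤ vol G Yᶜ ∧ (IsOutClosed G f Y ∨ IsOutClosed G f Yᶜ) := by
    rcases le_total (vol G S) (vol G Sᶜ) with h | h
    · exact ⟨S, ⟨u, hu⟩, ⟨w, hw⟩, h, Or.inl hSout⟩
    · exact ⟨Sᶜ, ⟨w, by simpa using hw⟩, ⟨u, by simpa using hu⟩, by simpa using h,
        Or.inr (by simpa using hSout)⟩
  obtain ⟨X, T, hT, hXY, hX⟩ := exists_isGrownTree_of_mem G hv
  refine ⟨X, fun h => hw' (hXY (h ▸ mem_univ _)), ?_, ⟨v, T, hT⟩, ?_⟩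
  · exact (vol_mono G hXY).trans (hvol.trans (vol_mono G (compl_subset_compl.2 hXY)))
  · refine hY.imp (fun h a ha b hb hab => ?_) (fun h a ha b hb hab => ?_)
    · by_cases hbY : b ∈ Y
      · exact hX a ha b hbY hb hab.1
      · exact h a (hXY ha) b hbY hab
    · simp only [mem_compl, not_not] at ha hb
      by_cases haY : a ∈ Y
      · exact hX b hb a haY ha hab.1.symm
      · exact h a (by simpa using haY) b (by simpa using hXY hb) hab

/-- Union bound over the cuts whose smaller side is spanned by a tree. -/
theorem one_sub_sum_le_orientProb (G : SimpleGraph (Fin n)) [DecidableRel G.Adj]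
    (F : Finset (Finset (Fin n)))
    (hF : ∀ X, X ≠ univ → vol G X ≤ vol G Xᶜ → (∃ v T, IsGrownTree G v X T) → X ∈ F) :
    1 - ∑ X ∈ F, 2 * (1 / 2 : ℝ) ^ crossCount G X ≤ orientProb G (IsStronglyConnected G) := by
  classical
  let ev (P : (G.edgeSet → Bool) → Prop) : Finset (G.edgeSet → Bool) :=
    @Finset.filter _ P (Classical.decPred _) univ
  have hcover : (univ : Finset (G.edgeSet → Bool)) ⊆ ev (IsStronglyConnected G) ∪
      F.biUnion fun X => ev (fun f => IsOutClosed G f X) ∪ ev (fun f => IsOutClosed G f Xᶜ) := by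
    intro f _
    by_cases hf : IsStronglyConnected G f
    · exact mem_union_left _ (mem_filter.2 ⟨mem_univ _, hf⟩)
    · obtain ⟨X, h₁, h₂, h₃, h₄⟩ := exists_grownTree_of_not_isStronglyConnected G hf
      refine mem_union_right _ (mem_biUnion.2 ⟨X, hF X h₁ h₂ h₃, mem_union.2 ?_⟩)
      exact h₄.imp (fun h => mem_filter.2 ⟨mem_univ _, h⟩) (fun h => mem_filter.2 ⟨mem_univ _, h⟩)
  have hcard : Fintype.card (G.edgeSet → Bool) ≤ (ev (IsStronglyConnected G)).card +
      ∑ X ∈ F, ((ev fun f => IsOutClosed G f X).card +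
        (ev fun f => IsOutClosed G f Xᶜ).card) := by
    refine (card_le_card hcover).trans ((card_union_le _ _).trans ?_)
    gcongr
    exact card_biUnion_le.trans (sum_le_sum fun X _ => card_union_le _ _)
  have hpos : (0 : ℝ) < Fintype.card (G.edgeSet → Bool) := by
    exact_mod_cast Fintype.card_pos
  have hprob : 1 ≤ orientProb G (IsStronglyConnected G) +
      ∑ X ∈ F, (orientProb G (fun f => IsOutClosed G f X) +
        orientProb G (fun f => IsOutClosed G f Xᶜ)) := by
    simp only [orientProb, ← add_div, ← sum_div]
    rw [one_le_div hpos]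
    exact_mod_cast hcard
  have hsum : ∑ X ∈ F, (orientProb G (fun f => IsOutClosed G f X) +
      orientProb G (fun f => IsOutClosed G f Xᶜ)) ≤
        ∑ X ∈ F, 2 * (1 / 2 : ℝ) ^ crossCount G X := by
    refine sum_le_sum fun X _ => ?_
    have h₁ := orientProb_isOutClosed_le G X
    have h₂ := orientProb_isOutClosed_le G Xᶜ
    rw [crossCount_compl] at h₂
    linarith
  linarith

theorem card_mul_le_crossCount (G : SimpleGraph (Fin n)) [DecidableRel G.Adj]
    (X : Finset (Fin n)) {d : ℝ} (hd : ∀ v, d ≤ G.degree v) :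
    (X.card : ℝ) * (d - (X.card - 1)) ≤ crossCount G X := by
  classical
  have hcross : crossCount G X = ∑ v ∈ X, (Xᶜ.filter fun w => G.Adj v w).card := by
    simp only [crossCount, card_filter, sum_product]
  rw [hcross, ← nsmul_eq_mul]
  push_cast
  refine card_nsmul_le_sum _ _ _ fun v hv => ?_
  have hsub : G.neighborFinset v ⊆ (Xᶜ.filter fun w => G.Adj v w) ∪ X.erase v := by
    intro w hw
    have hw : G.Adj v w := by simpa using hw
    by_cases hwX : w ∈ X
    · exact mem_union_right _ (mem_erase.2 ⟨hw.ne', hwX⟩)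
    · exact mem_union_left _ (by simp [hwX, hw])
  have h := (card_le_card hsub).trans (card_union_le _ _)
  have herase := card_erase_add_one hv
  rw [G.card_neighborFinset_eq_degree] at h
  have h' : (G.degree v : ℝ) ≤ (Xᶜ.filter fun w => G.Adj v w).card + ((X.erase v).card : ℝ) := by
    exact_mod_cast h
  have herase' : ((X.erase v).card : ℝ) + 1 = X.card := by exact_mod_cast herase
  linarith [hd v]

theorem half_pow_le_rpow {m : ℕ} {x : ℝ} (h : x ≤ m) : (1 / 2 : ℝ) ^ m ≤ 2 ^ (-x) := by
  have : (1 / 2 : ℝ) ^ m = 2 ^ (-(m : ℝ)) := by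
    rw [Real.rpow_neg (by norm_num), Real.rpow_natCast]
    simp
  rw [this]
  exact Real.rpow_le_rpow_of_exponent_le (by norm_num) (by linarith)

theorem two_thirds_pow_le_rpow {m : ℕ} {x : ℝ} (h : 2 * x ≤ m) :
    (2 / 3 : ℝ) ^ m ≤ 2 ^ (-x) := by
  have h₁ : ((2 / 3 : ℝ) ^ m) ^ 2 ≤ (2 ^ (-x)) ^ 2 := by
    calc ((2 / 3 : ℝ) ^ m) ^ 2 = (4 / 9) ^ m := by
          rw [← pow_mul, mul_comm, pow_mul]
          norm_num
      _ ≤ (1 / 2) ^ m := pow_le_pow_left₀ (by norm_num) (by norm_num) m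
      _ ≤ 2 ^ (-(2 * x)) := half_pow_le_rpow h
      _ = (2 ^ (-x)) ^ 2 := by
          rw [← Real.rpow_mul_natCast (by norm_num)]
          congr 1
          push_cast
          ring
  exact le_of_sq_le_sq h₁ (by positivity)

theorem sum_inv_pow_card_le (hn : 0 < n) :
    ∑ X : Finset (Fin n), ((n : ℝ)⁻¹) ^ X.card ≤ 3 := by
  have h := Fintype.sum_pow_mul_eq_add_pow (Fin n) ((n : ℝ)⁻¹) 1
  simp only [one_pow, mul_one, Fintype.card_fin] at h
  rw [h]
  have hn' : (0 : ℝ) < n := by exact_mod_cast hn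
  calc ((n : ℝ)⁻¹ + 1) ^ n ≤ (Real.exp (n : ℝ)⁻¹) ^ n := by
        gcongr
        exact Real.add_one_le_exp _
    _ = Real.exp 1 := by
        rw [← Real.exp_nat_mul, mul_inv_cancel₀ hn'.ne']
    _ ≤ 3 := Real.exp_one_lt_three.le

/-- **Theorem 1.1.** For `α > 0`, `ξ > 4`, there is `N₀` such that for all `n ≥ N₀`,
any graph `G` on `n` vertices with minimum degree at least `(1+α)·log₂ n` and Cheeger
constant greater than `ξ·log₂log₂ n / log₂ n` (i.e. every nonempty proper vertex subset
has Cheeger ratio exceeding this bound) has a random orientation that is strongly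
connected with probability at least `1 − (1 + 4α log₂ n)/(α n^α log₂ n)`. -/
theorem random_orientation_strongly_connected_whp (α ξ : ℝ) (hα : 0 < α) (hξ : 4 < ξ) :
    ∃ N₀ : ℕ, ∀ n : ℕ, N₀ ≤ n → ∀ (G : SimpleGraph (Fin n)) [DecidableRel G.Adj],
      (∀ v : Fin n, (1 + α) * Real.logb 2 n ≤ (G.degree v : ℝ)) →
      (∀ X : Finset (Fin n), X.Nonempty → X ≠ Finset.univ →
        ξ * (Real.logb 2 (Real.logb 2 n) / Real.logb 2 n) <
          (crossCount G X : ℝ) / min ((vol G X : ℝ)) ((vol G Xᶜ : ℝ))) →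
      1 - (1 + 4 * α * Real.logb 2 n) / (α * (n : ℝ) ^ α * Real.logb 2 n) ≤
        orientProb G (IsStronglyConnected G) := by
  classical
  have hL : Filter.Tendsto (fun n : ℕ => Real.logb 2 n) Filter.atTop Filter.atTop :=
    (Real.tendsto_logb_atTop (by norm_num)).comp tendsto_natCast_atTop_atTop
  have hLL : Filter.Tendsto (fun n : ℕ => Real.logb 2 (Real.logb 2 n)) Filter.atTop
      Filter.atTop := (Real.tendsto_logb_atTop (by norm_num)).comp hL
  have hev := ((Filter.eventually_ge_atTop 1).and ((hL.eventually_ge_atTop (6 / α)).and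
    ((hL.eventually_ge_atTop 1).and (hLL.eventually_ge_atTop (1 + 2 * (2 + α) / α)))))
  obtain ⟨N₀, hN₀⟩ := Filter.eventually_atTop.1 hev
  refine ⟨N₀, fun n hn G _ hdeg hcheeger => ?_⟩
  obtain ⟨hn1, hL6, hL1, hLL2⟩ := hN₀ n hn
  have hn0 : (0 : ℝ) < n := by exact_mod_cast hn1
  set L := Real.logb 2 n
  have hnL : (n : ℝ) = 2 ^ L := (Real.rpow_logb (by norm_num) (by norm_num) hn0).symm
  clear_value L
  have hαL : 6 ≤ α * L := by rwa [div_le_iff₀' hα] at hL6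
  have hLL1 : 1 ≤ Real.logb 2 L := le_trans (by simp; positivity) hLL2
  have hlarge : (1 + α) * L + 1 ≤ α * L / 2 * (Real.logb 2 L - 1) := by
    have h₁ : 2 * (2 + α) / α ≤ Real.logb 2 L - 1 := by linarith
    have h₂ : α * L / 2 * (2 * (2 + α) / α) ≤ α * L / 2 * (Real.logb 2 L - 1) := by gcongr
    have h₃ : α * L / 2 * (2 * (2 + α) / α) = (2 + α) * L := by field_simp
    linarith
  set F : Finset (Finset (Fin n)) := univ.filter fun X =>
    X ≠ univ ∧ vol G X ≤ vol G Xᶜ ∧ ∃ v T, IsGrownTree G v X T with hF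
  have hunion := one_sub_sum_le_orientProb G F fun X h₁ h₂ h₃ => by
    simp only [hF, mem_filter, mem_univ, true_and]
    exact ⟨h₁, h₂, h₃⟩
  set c : ℝ := 2 ^ (-((1 + α) * L)) with hc
  set q : ℝ := 2 ^ (-(3 / 2 * (α * L))) with hq
  set A : Finset (Fin n) → ℝ := fun X => if X.card = 1 then 2 * c else 0 with hA
  set B : Finset (Fin n) → ℝ := fun X => 2 * q * ((n : ℝ)⁻¹) ^ X.card with hB
  set C : Fin n → Finset (Fin n) → ℝ := fun v X => if ∃ T, IsGrownTree G v X T then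
    (1 / 4 : ℝ) ^ X.card * (3 / 4) ^ crossCount G X else 0 with hC
  have hA0 : ∀ X, 0 ≤ A X := fun X => by simp only [hA]; positivity
  have hB0 : ∀ X, 0 ≤ B X := fun X => by positivity
  have hC0 : ∀ v X, 0 ≤ C v X := fun v X => by simp only [hC]; positivity
  have hterm : ∀ X ∈ F, 2 * (1 / 2 : ℝ) ^ crossCount G X ≤ A X + B X + c * ∑ v, C v X := by
    intro X hX
    simp only [hF, mem_filter, mem_univ, true_and] at hX
    obtain ⟨hXuniv, hvol, v, T, hT⟩ := hX
    have hS0 : 0 ≤ c * ∑ v, C v X := mul_nonneg (by positivity) (sum_nonneg fun v _ => hC0 v X)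
    have hXpos : 1 ≤ X.card := card_pos.2 ⟨v, hT.root_mem⟩
    have hcross := card_mul_le_crossCount G X hdeg
    rcases hXpos.eq_or_lt with h1 | h2
    · rw [← h1] at hcross
      have h := half_pow_le_rpow (m := crossCount G X) (x := (1 + α) * L) (by simpa using hcross)
      have hAX : A X = 2 * c := by simp [hA, ← h1]
      linarith [hB0 X]
    have h2' : (2 : ℝ) ≤ X.card := by exact_mod_cast h2
    by_cases hsmall : (X.card : ℝ) ≤ α * L / 4
    · have h := half_pow_le_rpow (m := crossCount G X)
        (x := 3 / 2 * (α * L) + L * X.card) (by nlinarith)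
      have hBX : B X = 2 * 2 ^ (-(3 / 2 * (α * L) + L * X.card)) := by
        simp only [hB, hq]
        rw [neg_add, Real.rpow_add (by norm_num), Real.rpow_neg (by norm_num) (L * _),
          Real.rpow_mul (by norm_num), ← hnL, Real.rpow_natCast, inv_pow, mul_assoc]
      linarith [hA0 X]
    · push Not at hsmall
      have hvolX : (X.card : ℝ) * ((1 + α) * L) ≤ vol G X := by
        rw [← nsmul_eq_mul, vol]
        push_cast
        exact card_nsmul_le_sum _ _ _ fun v _ => hdeg v
      have hvolpos : (0 : ℝ) < vol G X := lt_of_lt_of_le (by positivity) hvolX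
      have hch := hcheeger X ⟨v, hT.root_mem⟩ hXuniv
      rw [min_eq_left (by exact_mod_cast hvol), lt_div_iff₀ hvolpos] at hch
      have hcut : 4 * (X.card * Real.logb 2 L) ≤ crossCount G X := by
        have hLpos : 0 < L := by linarith
        have h₁ : X.card * L ≤ (vol G X : ℝ) := by
          refine le_trans ?_ hvolX
          gcongr
          nlinarith
        calc 4 * (X.card * Real.logb 2 L) = 4 * (Real.logb 2 L / L) * (X.card * L) := by
              field_simp
          _ ≤ ξ * (Real.logb 2 L / L) * vol G X := by gcongr
          _ ≤ crossCount G X := hch.le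
      have h₂ := two_thirds_pow_le_rpow (m := crossCount G X)
        (x := 2 * (X.card * Real.logb 2 L)) (by linarith)
      have h4 : (4 : ℝ) ^ X.card = 2 ^ (2 * (X.card : ℝ)) := by
        rw [Real.rpow_mul (by norm_num), Real.rpow_natCast]
        norm_num
      have hkey : 2 * ((4 : ℝ) ^ X.card * (2 / 3) ^ crossCount G X) ≤ c := by
        calc 2 * ((4 : ℝ) ^ X.card * (2 / 3) ^ crossCount G X)
            ≤ 2 ^ (1 : ℝ) * (2 ^ (2 * (X.card : ℝ)) * 2 ^ (-(2 * (X.card * Real.logb 2 L)))) := by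
              rw [h4, Real.rpow_one]
              gcongr
          _ = 2 ^ (1 + (2 * (X.card : ℝ) + -(2 * (X.card * Real.logb 2 L)))) := by
              rw [Real.rpow_add (by norm_num), Real.rpow_add (by norm_num)]
          _ ≤ c := by
              refine Real.rpow_le_rpow_of_exponent_le (by norm_num) ?_
              nlinarith [mul_le_mul_of_nonneg_right hsmall.le (sub_nonneg.2 hLL1)]
      have hCX : (1 / 4 : ℝ) ^ X.card * (3 / 4) ^ crossCount G X ≤ ∑ v, C v X := by
        refine le_trans (le_of_eq ?_) (single_le_sum (fun w _ => hC0 w X) (mem_univ v))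
        simp only [hC]
        rw [if_pos ⟨T, hT⟩]
      have hsplit : 2 * (1 / 2 : ℝ) ^ crossCount G X =
          2 * ((4 : ℝ) ^ X.card * (2 / 3) ^ crossCount G X) *
            ((1 / 4 : ℝ) ^ X.card * (3 / 4) ^ crossCount G X) := by
        have e₁ : (4 : ℝ) ^ X.card * (1 / 4) ^ X.card = 1 := by rw [← mul_pow]; norm_num
        have e₂ : (2 / 3 : ℝ) ^ crossCount G X * (3 / 4) ^ crossCount G X =
            (1 / 2) ^ crossCount G X := by rw [← mul_pow]; norm_num
        calc _ = 2 * ((4 : ℝ) ^ X.card * (1 / 4) ^ X.card) *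
              ((2 / 3 : ℝ) ^ crossCount G X * (3 / 4) ^ crossCount G X) := by rw [e₁, e₂]; ring
          _ = _ := by ring
      have : 2 * (1 / 2 : ℝ) ^ crossCount G X ≤ c * ∑ v, C v X := by
        rw [hsplit]
        gcongr
      linarith [hA0 X, hB0 X]
  have hsumA : ∑ X, A X = n * (2 * c) := by
    simp only [hA]
    rw [← sum_filter, sum_const, nsmul_eq_mul]
    congr 2
    rw [← powerset_univ, ← powersetCard_eq_filter]
    simp
  have hsumB : ∑ X, B X ≤ 2 * q * 3 := by
    simp only [hB]
    rw [← mul_sum]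
    gcongr
    exact sum_inv_pow_card_le hn1
  have hsumC : ∑ X, c * ∑ v, C v X ≤ c * n := by
    rw [← mul_sum, sum_comm]
    gcongr
    calc ∑ v, ∑ X, C v X ≤ ∑ _v : Fin n, (1 : ℝ) := by
          refine sum_le_sum fun v _ => ?_
          simp only [hC]
          rw [← sum_filter]
          exact sum_grownTree_le_one G v _ fun X hX => (mem_filter.1 hX).2
      _ = n := by simp
  have htotal : ∑ X ∈ F, 2 * (1 / 2 : ℝ) ^ crossCount G X ≤
      n * (2 * c) + 2 * q * 3 + c * n := by
    calc _ ≤ ∑ X ∈ F, (A X + B X + c * ∑ v, C v X) := sum_le_sum hterm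
      _ ≤ ∑ X, (A X + B X + c * ∑ v, C v X) := by
          refine sum_le_sum_of_subset_of_nonneg (subset_univ _) fun X _ _ => ?_
          have := mul_nonneg (show 0 ≤ c by positivity) (sum_nonneg fun v (_ : v ∈ univ) => hC0 v X)
          linarith [hA0 X, hB0 X]
      _ ≤ _ := by
          rw [sum_add_distrib, sum_add_distrib, hsumA]
          gcongr
  have hnα : ((n : ℝ) ^ α)⁻¹ = 2 ^ (-(α * L)) := by
    rw [Real.rpow_neg (by norm_num), mul_comm, Real.rpow_mul (by norm_num), ← hnL]
  have hnc : n * c = ((n : ℝ) ^ α)⁻¹ := by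
    rw [hnα, hc, show (n : ℝ) * 2 ^ (-((1 + α) * L)) = 2 ^ L * 2 ^ (-((1 + α) * L)) by rw [← hnL],
      ← Real.rpow_add (by norm_num)]
    congr 1
    ring
  have hq6 : 6 * q ≤ ((n : ℝ) ^ α)⁻¹ := by
    calc 6 * q ≤ 2 ^ (3 : ℝ) * q := by
          gcongr
          norm_num
      _ = 2 ^ (3 + -(3 / 2 * (α * L))) := by rw [hq, Real.rpow_add (by norm_num)]
      _ ≤ 2 ^ (-(α * L)) := Real.rpow_le_rpow_of_exponent_le (by norm_num) (by linarith)
      _ = _ := hnα.symm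
  have hbound : 4 * ((n : ℝ) ^ α)⁻¹ ≤ (1 + 4 * α * L) / (α * (n : ℝ) ^ α * L) := by
    have hnαpos : 0 < (n : ℝ) ^ α := Real.rpow_pos_of_pos hn0 α
    have hLpos : 0 < L := by linarith
    rw [le_div_iff₀ (by positivity)]
    have : 4 * ((n : ℝ) ^ α)⁻¹ * (α * (n : ℝ) ^ α * L) = 4 * α * L := by field_simp
    linarith
  linarith
end

section
/- Let α > 0 and ξ > 4 be real numbers. There exists N₀ = N₀(α, ξ) such that for all n ≥ N₀ the following holds: if G is a finite simple graph on n vertices with minimum degree δ(G) ≥ (1+α)·log₂ n and the second-smallest eigenvalue λ₁ of the normalized Laplacian of G satisfies λ₁/2 > ξ·(log₂ log₂ n)/(log₂ n), then a uniformly random orientation of G is strongly connected with probability at least 1 − (1 + 4α·log₂ n)/(α·n^α·log₂ n). -/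
open Finset

variable {n : ℕ}

/-- The normalized Laplacian `ℒ = I − D^{-1/2} A D^{-1/2}` of `G`. -/
noncomputable def normLap (G : SimpleGraph (Fin n)) [DecidableRel G.Adj] :
    Matrix (Fin n) (Fin n) ℝ :=
  1 - Matrix.diagonal (fun v => (Real.sqrt (G.degree v))⁻¹) * G.adjMatrix ℝ *
        Matrix.diagonal (fun v => (Real.sqrt (G.degree v))⁻¹)

/-- The eigenvalues of a Hermitian real matrix, with multiplicity, sorted increasingly. -/
noncomputable def sortedEigenvalues {A : Matrix (Fin n) (Fin n) ℝ}
    (hA : A.IsHermitian) : List ℝ :=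
  (Finset.univ.val.map hA.eigenvalues).sort (· ≤ ·)


/-- The total product weight of the functions that are `true` on `T` and `false` on `B`. -/
theorem sum_cylinder_weight {ι : Type*} [Fintype ι] [DecidableEq ι] (w : Bool → ℝ)
    (hw : w true + w false = 1) (T B : Finset ι) (hTB : Disjoint T B) :
    ∑ F : ι → Bool with (∀ e ∈ T, F e = true) ∧ (∀ e ∈ B, F e = false), ∏ e, w (F e) =
      w true ^ #T * w false ^ #B := by
  classical
  have h : (univ.filter fun F : ι → Bool => (∀ e ∈ T, F e = true) ∧ (∀ e ∈ B, F e = false)) =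
      Fintype.piFinset fun e => if e ∈ T then {true} else if e ∈ B then {false} else univ := by
    ext F
    simp only [mem_filter, mem_univ, true_and, Fintype.mem_piFinset]
    constructor
    · rintro ⟨h1, h2⟩ e
      split_ifs with hT hB
      · simp [h1 e hT]
      · simp [h2 e hB]
      · simp
    · intro h
      refine ⟨fun e he => by simpa [he] using h e, fun e he => ?_⟩
      have hT : e ∉ T := fun hT => Finset.disjoint_left.mp hTB hT he
      simpa [he, hT] using h e
  rw [h, ← Finset.prod_univ_sum]
  have h2 : ∀ e, ∑ j ∈ (if e ∈ T then {true} else if e ∈ B then {false} else univ : Finset Bool),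
      w j = (if e ∈ T then w true else 1) * (if e ∈ B then w false else 1) := by
    intro e
    by_cases hT : e ∈ T
    · have hB : e ∉ B := Finset.disjoint_left.mp hTB hT
      simp [hT, hB]
    · by_cases hB : e ∈ B <;> simp [hT, hB, hw]
  simp_rw [h2, Finset.prod_mul_distrib, Finset.prod_ite_mem, univ_inter, prod_const]

/-- A family of Boolean functions that all agree on `B` has density at most `2 ^ (-#B)`. -/
theorem card_mul_two_pow_le_of_agree {ι : Type*} [Fintype ι] [DecidableEq ι]
    (X : Finset (ι → Bool)) (B : Finset ι)
    (h : ∀ f ∈ X, ∀ g ∈ X, ∀ e ∈ B, f e = g e) :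
    (#X : ℝ) ≤ (1 / 2) ^ #B * (Fintype.card (ι → Bool) : ℝ) := by
  rcases X.eq_empty_or_nonempty with rfl | ⟨g, hg⟩
  · simp only [card_empty, Nat.cast_zero]; positivity
  have hsub : X ⊆ Fintype.piFinset fun e => if e ∈ B then {g e} else univ := by
    intro f hf
    rw [Fintype.mem_piFinset]
    intro e
    split_ifs with he
    · simp [h f hf g hg e he]
    · simp
  have hc := card_le_card hsub
  rw [Fintype.card_piFinset] at hc
  have h3 : ∀ e, (#(if e ∈ B then {g e} else univ : Finset Bool) : ℝ) =
      (if e ∈ B then 1 / 2 else 1) * 2 := by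
    intro e; split_ifs <;> simp
  have h4 : ((∏ e, #(if e ∈ B then {g e} else univ : Finset Bool) : ℕ) : ℝ) =
      (1 / 2) ^ #B * (Fintype.card (ι → Bool) : ℝ) := by
    push_cast
    simp_rw [h3]
    rw [Finset.prod_mul_distrib, Finset.prod_ite_mem, univ_inter, prod_const]
    simp
  rw [← h4]
  exact_mod_cast hc

section Boundary

variable {V : Type*} [DecidableEq V]

/-- `T` is a set of edges of `G` inside `S` that joins every vertex of `S` to `v`, and is no
larger than a spanning tree. -/
structure Spans (G : SimpleGraph V) (v : V) (S : Finset V) (T : Finset (Sym2 V)) : Prop where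
  mem : v ∈ S
  card_lt : #T + 1 ≤ #S
  adj : ∀ a b, s(a, b) ∈ T → G.Adj a b ∧ a ∈ S ∧ b ∈ S
  reach : ∀ w ∈ S, Relation.ReflTransGen (fun a b => s(a, b) ∈ T) v w

theorem Spans.insert {G : SimpleGraph V} {v : V} {S : Finset V}
    {T : Finset (Sym2 V)} (h : Spans G v S T) {a b : V} (ha : a ∈ S) (hb : b ∉ S)
    (hab : G.Adj a b) : Spans G v (insert b S) (insert s(a, b) T) where
  mem := mem_insert_of_mem h.mem
  card_lt := by
    rw [card_insert_of_notMem hb]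
    have := card_insert_le s(a, b) T
    have := h.card_lt
    omega
  adj c d hcd := by
    rcases mem_insert.mp hcd with hcd | hcd
    · rcases Sym2.eq_iff.mp hcd with ⟨rfl, rfl⟩ | ⟨rfl, rfl⟩
      · simp [hab, ha]
      · simp [hab.symm, ha]
    · obtain ⟨h1, h2, h3⟩ := h.adj c d hcd
      simp [h1, h2, h3]
  reach w hw := by
    have hS : ∀ w ∈ S, Relation.ReflTransGen
        (fun c d => s(c, d) ∈ Insert.insert s(a, b) T) v w := fun w hw =>
      Relation.ReflTransGen.mono (fun _ _ h => mem_insert_of_mem h) _ _ (h.reach w hw)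
    rcases mem_insert.mp hw with rfl | hw
    · exact (hS a ha).tail (mem_insert_self _ _)
    · exact hS w hw

variable [Fintype V]

/-- The edges of `G` with exactly one endpoint in `S`. -/
def edgeBoundary (G : SimpleGraph V) [DecidableRel G.Adj] (S : Finset V) : Finset (Sym2 V) :=
  (univ.filter fun p : V × V => p.1 ∈ S ∧ p.2 ∉ S ∧ G.Adj p.1 p.2).image fun p => s(p.1, p.2)

theorem mem_edgeBoundary {G : SimpleGraph V} [DecidableRel G.Adj] {S : Finset V} {e : Sym2 V} :
    e ∈ edgeBoundary G S ↔ ∃ a b, a ∈ S ∧ b ∉ S ∧ G.Adj a b ∧ s(a, b) = e := by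
  simp [edgeBoundary, and_assoc]

theorem card_edgeBoundary (G : SimpleGraph V) [DecidableRel G.Adj] (S : Finset V) :
    #(edgeBoundary G S) = ∑ a ∈ S, #(univ.filter fun b => b ∉ S ∧ G.Adj a b) := by
  rw [edgeBoundary, card_image_of_injOn]
  · simp only [card_filter, ← univ_product_univ, sum_product]
    rw [← sum_filter_add_sum_filter_not univ (· ∈ S)]
    simp only [filter_mem_eq_inter, univ_inter]
    rw [sum_congr rfl (g := fun a => ∑ b, if b ∉ S ∧ G.Adj a b then 1 else 0)
      (fun a ha => by simp [ha]), add_eq_left]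
    refine sum_eq_zero fun a ha => ?_
    simp [(mem_filter.mp ha).2]
  · rintro ⟨a, b⟩ h1 ⟨c, d⟩ h2 h
    simp only [coe_filter, mem_univ, true_and, Set.mem_ofPred_eq] at h1 h2
    rcases Sym2.eq_iff.mp h with ⟨rfl, rfl⟩ | ⟨rfl, rfl⟩
    · rfl
    · exact absurd h1.1 h2.2.1

theorem degree_le_card_outside (G : SimpleGraph V) [DecidableRel G.Adj] (S : Finset V) {a : V}
    (ha : a ∈ S) : G.degree a + 1 ≤ #(univ.filter fun b => b ∉ S ∧ G.Adj a b) + #S := by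
  have h : G.neighborFinset a ⊆ (univ.filter fun b => b ∉ S ∧ G.Adj a b) ∪ S.erase a := by
    intro b hb
    rw [SimpleGraph.mem_neighborFinset] at hb
    by_cases hS : b ∈ S
    · simp [hS, hb.ne']
    · simp [hS, hb]
  have h1 := (card_le_card h).trans (card_union_le _ _)
  rw [SimpleGraph.card_neighborFinset_eq_degree] at h1
  have := card_erase_add_one ha
  omega

theorem le_card_edgeBoundary (G : SimpleGraph V) [DecidableRel G.Adj] (S : Finset V) {D : ℝ}
    (hD : ∀ v, D ≤ G.degree v) : #S * (D + 1 - #S) ≤ (#(edgeBoundary G S) : ℝ) := by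
  rw [card_edgeBoundary, Nat.cast_sum, ← nsmul_eq_mul]
  refine card_nsmul_le_sum _ _ _ fun a ha => ?_
  have h := degree_le_card_outside G S ha
  have h' : (G.degree a : ℝ) + 1 ≤ (#(univ.filter fun b => b ∉ S ∧ G.Adj a b) : ℝ) + #S := by
    exact_mod_cast h
  linarith [hD a]

theorem Spans.disjoint {G : SimpleGraph V} [DecidableRel G.Adj] {v : V} {S : Finset V}
    {T : Finset (Sym2 V)} (h : Spans G v S T) : Disjoint T (edgeBoundary G S) := by
  rw [Finset.disjoint_left]
  intro e he hb
  obtain ⟨a, b, -, hbS, -, rfl⟩ := mem_edgeBoundary.mp hb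
  exact hbS (h.adj a b he).2.2

/-- The set of vertices reachable along a subrelation of adjacency is spanned by a tree. -/
theorem exists_spans_of_reflTransGen {G : SimpleGraph V} {r : V → V → Prop}
    (hr : ∀ a b, r a b → G.Adj a b) (v : V) (S : Finset V)
    (hS : ∀ w, w ∈ S ↔ Relation.ReflTransGen r v w) : ∃ T, Spans G v S T := by
  classical
  have hne : (S.powerset.filter fun S' => ∃ T, Spans G v S' T).Nonempty := by
    refine ⟨{v}, mem_filter.mpr ⟨?_, ∅, ?_⟩⟩
    · simp only [mem_powerset, singleton_subset_iff]
      exact (hS v).mpr .refl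
    · refine ⟨by simp, by simp, by simp, fun w hw => ?_⟩
      rw [mem_singleton.mp hw]
  obtain ⟨M, hM, hmax⟩ := exists_max_image _ card hne
  obtain ⟨hMS, T, hT⟩ := mem_filter.mp hM
  rw [mem_powerset] at hMS
  suffices h : S ⊆ M by
    rw [Subset.antisymm h hMS]
    exact ⟨T, hT⟩
  intro w hw
  rw [hS] at hw
  induction hw with
  | refl => exact hT.mem
  | @tail a b hva hab ih =>
    by_contra hb
    have h1 := hmax (insert b M) (mem_filter.mpr ⟨?_, _, hT.insert ih hb (hr _ _ hab)⟩)
    · rw [card_insert_of_notMem hb] at h1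
      omega
    · rw [mem_powerset]
      exact insert_subset ((hS b).mpr (hva.tail hab)) hMS

/-- If the open edges contain a spanning set of `S` and avoid the boundary of `S'`,
then `S` is contained in `S'`. -/
theorem Spans.subset {G : SimpleGraph V} [DecidableRel G.Adj] {v : V} {S S' : Finset V}
    {T : Finset (Sym2 V)} (h : Spans G v S T) (hv : v ∈ S')
    (hT : Disjoint T (edgeBoundary G S')) : S ⊆ S' := by
  intro w hw
  have := h.reach w hw
  clear hw
  induction this with
  | refl => exact hv
  | @tail a b _ hab ih =>
    by_contra hb
    exact Finset.disjoint_left.mp hT hab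
      (mem_edgeBoundary.mpr ⟨a, b, ih, hb, (h.adj a b hab).1, rfl⟩)

/-- Comparison with bond percolation: the clusters of `v` have total weight at most one. -/
theorem sum_cluster_weight_le_one (G : SimpleGraph V) [DecidableRel G.Adj] (v : V) {p : ℝ}
    (hp0 : 0 ≤ p) (hp1 : p ≤ 1) (𝒮 : Finset (Finset V)) (h𝒮 : ∀ S ∈ 𝒮, ∃ T, Spans G v S T) :
    ∑ S ∈ 𝒮, p ^ (#S - 1) * (1 - p) ^ #(edgeBoundary G S) ≤ 1 := by
  classical
  choose! T hT using h𝒮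
  let w : Bool → ℝ := fun b => if b then p else 1 - p
  have hw0 : ∀ b, 0 ≤ w b := by intro b; cases b <;> simp [w, hp0, hp1]
  have hw : w true + w false = 1 := by simp [w]
  let X : Finset V → Finset (Sym2 V → Bool) := fun S =>
    univ.filter fun F => (∀ e ∈ T S, F e = true) ∧ (∀ e ∈ edgeBoundary G S, F e = false)
  have hX : ∀ S ∈ 𝒮, ∑ F ∈ X S, ∏ e, w (F e) =
      w true ^ #(T S) * w false ^ #(edgeBoundary G S) := fun S hS =>
    sum_cylinder_weight w hw _ _ (hT S hS).disjoint
  have hsub : ∀ S ∈ 𝒮, ∀ S' ∈ 𝒮, ∀ F, F ∈ X S → F ∈ X S' → S ⊆ S' := by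
    intro S hS S' hS' F hF hF'
    refine (hT S hS).subset (hT S' hS').mem (Finset.disjoint_left.mpr fun e he he' => ?_)
    have h1 := (mem_filter.mp hF).2.1 e he
    have h2 := (mem_filter.mp hF').2.2 e he'
    simp [h1] at h2
  have hdisj : (𝒮 : Set (Finset V)).PairwiseDisjoint X := by
    intro S hS S' hS' hne
    refine Finset.disjoint_left.mpr fun F hF hF' => hne ?_
    exact Subset.antisymm (hsub S hS S' hS' F hF hF') (hsub S' hS' S hS F hF' hF)
  calc ∑ S ∈ 𝒮, p ^ (#S - 1) * (1 - p) ^ #(edgeBoundary G S)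
      ≤ ∑ S ∈ 𝒮, ∑ F ∈ X S, ∏ e, w (F e) := by
        refine sum_le_sum fun S hS => ?_
        rw [hX S hS]
        have := (hT S hS).card_lt
        simp only [w, if_true, Bool.false_eq_true, if_false]
        refine mul_le_mul_of_nonneg_right ?_ (pow_nonneg (by linarith) _)
        exact pow_le_pow_of_le_one hp0 hp1 (by omega)
    _ = ∑ F ∈ 𝒮.biUnion X, ∏ e, w (F e) := (sum_biUnion hdisj).symm
    _ ≤ ∑ F : Sym2 V → Bool, ∏ e, w (F e) :=
        sum_le_sum_of_subset_of_nonneg (subset_univ _) fun F _ _ =>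
          prod_nonneg fun e _ => hw0 _
    _ = 1 := by
        simpa using sum_cylinder_weight (ι := Sym2 V) w hw ∅ ∅ (by simp)

end Boundary

/-- All eigenvalues but one are at least the second entry of the sorted list. -/
theorem exists_forall_ne_getD_le {A : Matrix (Fin n) (Fin n) ℝ} (hA : A.IsHermitian)
    (hn : 2 ≤ n) : ∃ i₀, ∀ i, i ≠ i₀ → (sortedEigenvalues hA).getD 1 0 ≤ hA.eigenvalues i := by
  have hlen : (sortedEigenvalues hA).length = n := by simp [sortedEigenvalues]
  have hsort : (sortedEigenvalues hA).Pairwise (· ≤ ·) := Multiset.pairwise_sort _ _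
  have hcoe : ((sortedEigenvalues hA : List ℝ) : Multiset ℝ) =
      Finset.univ.val.map hA.eigenvalues := Multiset.sort_eq _ _
  generalize sortedEigenvalues hA = l at *
  match l, hlen with
  | [], h => simp at h; omega
  | [_], h => simp at h; omega
  | a :: b :: t, _ =>
    have ha : a ∈ Finset.univ.val.map hA.eigenvalues := by rw [← hcoe]; simp
    obtain ⟨i₀, -, rfl⟩ := Multiset.mem_map.mp ha
    refine ⟨i₀, fun i hi => ?_⟩
    have h1 : Finset.univ.val.map hA.eigenvalues =
        hA.eigenvalues i₀ ::ₘ (univ.erase i₀).val.map hA.eigenvalues := by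
      rw [← Multiset.map_cons, erase_val, Multiset.cons_erase (mem_univ_val i₀)]
    rw [h1, ← Multiset.cons_coe, Multiset.cons_inj_right] at hcoe
    have h2 : hA.eigenvalues i ∈ (univ.erase i₀).val.map hA.eigenvalues :=
      Multiset.mem_map_of_mem _ (mem_erase.mpr ⟨hi, mem_univ i⟩)
    rw [← hcoe, Multiset.mem_coe, List.mem_cons] at h2
    have h3 := (List.pairwise_cons.mp (List.pairwise_cons.mp hsort).2).1
    rcases h2 with h2 | h2
    · simp [h2]
    · simpa using h3 _ h2

/-- Rayleigh quotient bound for a real symmetric matrix with a known kernel vector and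
all but one eigenvalue at least `μ > 0`. -/
theorem mul_gram_le_quadForm {ι : Type*} [Fintype ι] [DecidableEq ι] {A : Matrix ι ι ℝ}
    (hA : A.IsHermitian) {μ : ℝ} (hμ : 0 < μ) (i₀ : ι) (h : ∀ i, i ≠ i₀ → μ ≤ hA.eigenvalues i)
    (φ x : ι → ℝ) (hφ : A.mulVec φ = 0) :
    μ * ((x ⬝ᵥ x) * (φ ⬝ᵥ φ) - (x ⬝ᵥ φ) ^ 2) ≤ (x ⬝ᵥ A.mulVec x) * (φ ⬝ᵥ φ) := by
  let u : ι → ι → ℝ := fun i => ⇑(hA.eigenvectorBasis i)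
  have hpar : ∀ y z : ι → ℝ, y ⬝ᵥ z = ∑ i, (u i ⬝ᵥ y) * (u i ⬝ᵥ z) := by
    intro y z
    have := hA.eigenvectorBasis.sum_inner_mul_inner (WithLp.toLp 2 z) (WithLp.toLp 2 y)
    simp only [EuclideanSpace.inner_eq_star_dotProduct, star_trivial] at this
    rw [← this]
    refine sum_congr rfl fun i _ => ?_
    rw [dotProduct_comm y, mul_comm]
  have hAu : ∀ i (y : ι → ℝ), u i ⬝ᵥ A.mulVec y = hA.eigenvalues i * (u i ⬝ᵥ y) := by
    intro i y
    have hT : A.transpose = A := by simpa [Matrix.conjTranspose_eq_transpose_of_trivial] using hA.eq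
    have h1 : A.mulVec (u i) = hA.eigenvalues i • u i := hA.mulVec_eigenvectorBasis i
    rw [Matrix.dotProduct_mulVec, ← Matrix.mulVec_transpose, hT, h1, smul_dotProduct, smul_eq_mul]
  have hφ0 : ∀ i, i ≠ i₀ → u i ⬝ᵥ φ = 0 := by
    intro i hi
    have h1 := hAu i φ
    rw [hφ, dotProduct_zero] at h1
    exact (mul_eq_zero.mp h1.symm).resolve_left (hμ.trans_le (h i hi)).ne'
  have hφi : ∀ y : ι → ℝ, y ⬝ᵥ φ = (u i₀ ⬝ᵥ y) * (u i₀ ⬝ᵥ φ) := by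
    intro y
    rw [hpar]
    exact sum_eq_single i₀ (fun i _ hi => by rw [hφ0 i hi, mul_zero]) (by simp)
  have h0 : hA.eigenvalues i₀ * (u i₀ ⬝ᵥ φ) = 0 := by
    rw [← hAu, hφ, dotProduct_zero]
  rw [hφi x, hφi φ, hpar x x, hpar x (A.mulVec x)]
  simp_rw [hAu]
  rw [← add_sum_erase _ _ (mem_univ i₀), ← add_sum_erase _ _ (mem_univ i₀)]
  have hs : μ * ∑ i ∈ univ.erase i₀, (u i ⬝ᵥ x) * (u i ⬝ᵥ x) ≤
      ∑ i ∈ univ.erase i₀, (u i ⬝ᵥ x) * (hA.eigenvalues i * (u i ⬝ᵥ x)) := by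
    rw [mul_sum]
    refine sum_le_sum fun i hi => ?_
    nlinarith [h i (ne_of_mem_erase hi), mul_self_nonneg (u i ⬝ᵥ x)]
  have := mul_le_mul_of_nonneg_right hs (mul_self_nonneg (u i₀ ⬝ᵥ φ))
  linear_combination this - (u i₀ ⬝ᵥ x) ^ 2 * (u i₀ ⬝ᵥ φ) * h0

theorem normLap_mulVec_sqrt_degree (G : SimpleGraph (Fin n)) [DecidableRel G.Adj]
    (hd : ∀ v, 0 < G.degree v) (y : Fin n → ℝ) (v : Fin n) :
    (normLap G).mulVec (fun u => √(G.degree u) * y u) v =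
      (√(G.degree v))⁻¹ * ∑ u, if G.Adj v u then y v - y u else 0 := by
  have hs : ∀ u, √(G.degree u : ℝ) ≠ 0 := fun u =>
    (Real.sqrt_pos.mpr (by exact_mod_cast hd u)).ne'
  have h1 : (fun u => (√(G.degree u : ℝ))⁻¹ * (√(G.degree u) * y u)) = y := by
    ext u; rw [inv_mul_cancel_left₀ (hs u)]
  have h2 : (∑ u, if G.Adj v u then y v - y u else 0) =
      G.degree v * y v - ∑ u ∈ G.neighborFinset v, y u := by
    rw [← sum_filter, ← SimpleGraph.neighborFinset_eq_filter, sum_sub_distrib, sum_const,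
      nsmul_eq_mul, SimpleGraph.card_neighborFinset_eq_degree]
  have h3 : (√(G.degree v : ℝ)) * y v = (√(G.degree v : ℝ))⁻¹ * (G.degree v * y v) := by
    rw [eq_inv_mul_iff_mul_eq₀ (hs v), ← mul_assoc, Real.mul_self_sqrt (Nat.cast_nonneg _)]
  rw [normLap, Matrix.sub_mulVec, Matrix.one_mulVec, Pi.sub_apply, ← Matrix.mulVec_mulVec,
    ← Matrix.mulVec_mulVec, Matrix.mulVec_diagonal, h2, mul_sub, ← h3]
  congr 2
  rw [SimpleGraph.adjMatrix_mulVec_apply]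
  refine sum_congr rfl fun u _ => ?_
  rw [Matrix.mulVec_diagonal, inv_mul_cancel_left₀ (hs u)]

/-- The easy direction of Cheeger's inequality for the normalized Laplacian. -/
theorem half_eigenvalue_mul_vol_le (G : SimpleGraph (Fin n)) [DecidableRel G.Adj] (hn : 2 ≤ n)
    (hd : ∀ v, 0 < G.degree v) (hH : (normLap G).IsHermitian)
    (hμ : 0 < (sortedEigenvalues hH).getD 1 0) (S : Finset (Fin n))
    (hS : 2 * ∑ v ∈ S, G.degree v ≤ ∑ v, G.degree v) :
    (sortedEigenvalues hH).getD 1 0 / 2 * ∑ v ∈ S, (G.degree v : ℝ) ≤ #(edgeBoundary G S) := by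
  obtain ⟨i₀, hi₀⟩ := exists_forall_ne_getD_le hH hn
  set μ := (sortedEigenvalues hH).getD 1 0
  let φ : Fin n → ℝ := fun u => √(G.degree u) * 1
  let x : Fin n → ℝ := fun u => √(G.degree u) * if u ∈ S then 1 else 0
  have hφ : (normLap G).mulVec φ = 0 := by
    ext v
    rw [normLap_mulVec_sqrt_degree G hd]
    simp
  have hsq : ∀ v, √(G.degree v : ℝ) * √(G.degree v : ℝ) = G.degree v := fun v =>
    Real.mul_self_sqrt (Nat.cast_nonneg _)
  have h := mul_gram_le_quadForm hH hμ i₀ hi₀ φ x hφ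
  have h1 : φ ⬝ᵥ φ = ∑ v, (G.degree v : ℝ) := by
    simp [φ, dotProduct, hsq]
  have h2 : x ⬝ᵥ φ = ∑ v ∈ S, (G.degree v : ℝ) := by
    simp [φ, x, dotProduct, hsq]
  have h3 : x ⬝ᵥ x = ∑ v ∈ S, (G.degree v : ℝ) := by
    simp [x, dotProduct, hsq]
  have h4 : x ⬝ᵥ (normLap G).mulVec x = #(edgeBoundary G S) := by
    have hs : ∀ u, √(G.degree u : ℝ) ≠ 0 := fun u =>
      (Real.sqrt_pos.mpr (by exact_mod_cast hd u)).ne'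
    rw [card_edgeBoundary, Nat.cast_sum, dotProduct, ← sum_filter_add_sum_filter_not univ (· ∈ S)]
    simp only [filter_mem_eq_inter, univ_inter]
    rw [sum_eq_zero (s := univ.filter _) (fun a ha => by simp [x, (mem_filter.mp ha).2]), add_zero]
    refine sum_congr rfl fun a ha => ?_
    rw [normLap_mulVec_sqrt_degree G hd]
    simp only [x, ha, if_true, mul_one]
    rw [mul_inv_cancel_left₀ (hs a), card_filter, Nat.cast_sum]
    refine sum_congr rfl fun b _ => ?_
    by_cases hb : b ∈ S <;> by_cases hab : G.Adj a b <;> simp [hb, hab]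
  rw [h1, h2, h3, h4] at h
  have hS' : 2 * ∑ v ∈ S, (G.degree v : ℝ) ≤ ∑ v, (G.degree v : ℝ) := by exact_mod_cast hS
  have hvol : 0 < ∑ v, (G.degree v : ℝ) := by
    have : NeZero n := ⟨by omega⟩
    exact sum_pos (fun v _ => by exact_mod_cast hd v) ⟨0, mem_univ _⟩
  have hs0 : 0 ≤ ∑ v ∈ S, (G.degree v : ℝ) := by positivity
  refine le_of_mul_le_mul_right ?_ hvol
  nlinarith [mul_nonneg (mul_nonneg hμ.le hs0) (sub_nonneg.mpr hS')]

theorem two_thirds_pow_le (b : ℕ) : (2 / 3 : ℝ) ^ b ≤ 2 ^ (-(7 / 12 * b) : ℝ) := by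
  have h : (2 / 3 : ℝ) ≤ 2 ^ (-(7 / 12) : ℝ) := by
    refine le_of_pow_le_pow_left₀ (n := 12) (by norm_num) (by positivity) ?_
    rw [← Real.rpow_mul_natCast (by norm_num)]
    rw [show (-(7 / 12) * ((12 : ℕ) : ℝ) : ℝ) = ((-7 : ℤ) : ℝ) by norm_num, Real.rpow_intCast]
    norm_num
  refine (pow_le_pow_left₀ (by norm_num) h b).trans_eq ?_
  rw [← Real.rpow_mul_natCast (by norm_num), neg_mul]

/-- Sets with two or more vertices have boundaries so large that their cut probability is
dominated by `2 ^ (-D)` times their percolation weight at density `1 / 4`. -/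
theorem half_pow_le_cluster_weight {k b : ℕ} {D : ℝ} (hD : 19 ≤ D) (hk : 2 ≤ k)
    (hb : k * (D + 1 - k) ≤ b) (hb' : 8 * (k : ℝ) ≤ b) :
    (1 / 2 : ℝ) ^ b ≤ 2 ^ (-D) * ((1 / 4) ^ (k - 1) * (1 - 1 / 4) ^ b) := by
  have hk' : (2 : ℝ) ≤ k := by exact_mod_cast hk
  have hexp : D + 2 * (k - 1) ≤ 7 / 12 * b := by
    rcases le_total (k : ℝ) (D / 2) with h | h
    · nlinarith [mul_nonneg (sub_nonneg.mpr hk') (sub_nonneg.mpr h)]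
    · linarith
  have h4 : (1 / 4 : ℝ) ^ (k - 1) = 2 ^ (-(2 * ((k : ℝ) - 1))) := by
    rw [show (1 / 4 : ℝ) = 2 ^ (-2 : ℝ) by
      rw [show (-2 : ℝ) = ((-2 : ℤ) : ℝ) by norm_num, Real.rpow_intCast]; norm_num,
      ← Real.rpow_mul_natCast (by norm_num), Nat.cast_sub (by omega)]
    congr 1
    push_cast
    ring
  have h1 : (2 / 3 : ℝ) ^ b ≤ 2 ^ (-D) * (1 / 4) ^ (k - 1) := by
    refine (two_thirds_pow_le b).trans ?_
    rw [h4, ← Real.rpow_add (by norm_num)]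
    exact Real.rpow_le_rpow_of_exponent_le (by norm_num) (by linarith)
  calc (1 / 2 : ℝ) ^ b = (2 / 3) ^ b * (1 - 1 / 4) ^ b := by rw [← mul_pow]; norm_num
    _ ≤ 2 ^ (-D) * (1 / 4) ^ (k - 1) * (1 - 1 / 4) ^ b := by gcongr
    _ = _ := mul_assoc _ _ _

/-- The boundaries of the clusters of `v` from a family of sets with large boundary
have total cut probability at most `2 * 2 ^ (-D)`. -/
theorem sum_half_pow_edgeBoundary_le {V : Type*} [Fintype V] [DecidableEq V] (G : SimpleGraph V)
    [DecidableRel G.Adj] {D : ℝ} (hD : 19 ≤ D) (hdeg : ∀ v, D ≤ G.degree v) (v : V)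
    (𝒮 : Finset (Finset V)) (h𝒮 : ∀ S ∈ 𝒮, ∃ T, Spans G v S T)
    (hbd : ∀ S ∈ 𝒮, 8 * (#S : ℝ) ≤ #(edgeBoundary G S)) :
    ∑ S ∈ 𝒮, (1 / 2 : ℝ) ^ #(edgeBoundary G S) ≤ 2 * 2 ^ (-D) := by
  have hmem : ∀ S ∈ 𝒮, v ∈ S := fun S hS => (h𝒮 S hS).choose_spec.mem
  have h1 : ∑ S ∈ 𝒮 with S = {v}, (1 / 2 : ℝ) ^ #(edgeBoundary G S) ≤ 2 ^ (-D) := by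
    have hsub : (𝒮.filter fun S => S = {v}) ⊆ {{v}} := fun S hS => by
      simpa using (mem_filter.mp hS).2
    refine (sum_le_sum_of_subset_of_nonneg hsub fun _ _ _ => by positivity).trans ?_
    rw [sum_singleton]
    have hb := le_card_edgeBoundary G {v} hdeg
    rw [card_singleton, Nat.cast_one, one_mul, add_sub_cancel_right] at hb
    calc (1 / 2 : ℝ) ^ #(edgeBoundary G {v}) = 2 ^ (-(#(edgeBoundary G {v}) : ℝ)) := by
          rw [Real.rpow_neg (by norm_num), Real.rpow_natCast, one_div, inv_pow]
      _ ≤ 2 ^ (-D) := Real.rpow_le_rpow_of_exponent_le (by norm_num) (by linarith)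
  have h2 : ∑ S ∈ 𝒮 with S ≠ {v}, (1 / 2 : ℝ) ^ #(edgeBoundary G S) ≤ 2 ^ (-D) := by
    have hle : ∀ S ∈ 𝒮.filter (fun S => S ≠ {v}), (1 / 2 : ℝ) ^ #(edgeBoundary G S) ≤
        2 ^ (-D) * ((1 / 4) ^ (#S - 1) * (1 - 1 / 4) ^ #(edgeBoundary G S)) := by
      intro S hS
      obtain ⟨hS, hne⟩ := mem_filter.mp hS
      refine half_pow_le_cluster_weight hD ?_ (le_card_edgeBoundary G S hdeg) (hbd S hS)
      have hpos := card_pos.mpr ⟨v, hmem S hS⟩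
      by_contra hlt
      obtain ⟨a, rfl⟩ := card_eq_one.mp (show #S = 1 by omega)
      have := hmem _ hS
      simp only [mem_singleton] at this
      exact hne (by rw [this])
    refine (sum_le_sum hle).trans ?_
    rw [← mul_sum]
    refine mul_le_of_le_one_right (by positivity) ?_
    exact sum_cluster_weight_le_one G v (by norm_num) (by norm_num) _
      fun S hS => h𝒮 S (mem_filter.mp hS).1
  rw [← sum_filter_add_sum_filter_not 𝒮 (fun S => S = {v})]
  linarith

/-- An orientation that is not strongly connected has a connected set of at most half the volume
that no arc leaves or that no arc enters. -/
theorem exists_spans_of_not_isStronglyConnected (G : SimpleGraph (Fin n)) [DecidableRel G.Adj]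
    (f : G.edgeSet → Bool) (hf : ¬ IsStronglyConnected G f) :
    ∃ v S, (∃ T, Spans G v S T) ∧ 2 * ∑ u ∈ S, G.degree u ≤ ∑ u, G.degree u ∧
      ((∀ a ∈ S, ∀ b ∉ S, ¬ dirAdj G f a b) ∨ ∀ a ∈ S, ∀ b ∉ S, ¬ dirAdj G f b a) := by
  classical
  unfold IsStronglyConnected at hf
  push Not at hf
  obtain ⟨u, w, huw⟩ := hf
  let r' : Fin n → Fin n → Prop := fun a b => dirAdj G f b a
  let A : Finset (Fin n) := univ.filter fun x => Relation.ReflTransGen (dirAdj G f) u x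
  let B : Finset (Fin n) := univ.filter fun x => Relation.ReflTransGen r' w x
  have hA : ∀ x, x ∈ A ↔ Relation.ReflTransGen (dirAdj G f) u x := fun x => by simp [A]
  have hB : ∀ x, x ∈ B ↔ Relation.ReflTransGen r' w x := fun x => by simp [B]
  have hdisj : Disjoint A B := Finset.disjoint_left.mpr fun x hxA hxB =>
    huw (((hA x).mp hxA).trans (Relation.reflTransGen_swap.mp ((hB x).mp hxB)))
  have hvol : ∑ u ∈ A, G.degree u + ∑ u ∈ B, G.degree u ≤ ∑ u, G.degree u := by
    rw [← sum_union hdisj]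
    exact sum_le_sum_of_subset (subset_univ _)
  by_cases h : 2 * ∑ u ∈ A, G.degree u ≤ ∑ u, G.degree u
  · exact ⟨u, A, exists_spans_of_reflTransGen (fun a b h => h.1) u A hA, h, Or.inl
      fun a ha b hb hab => hb ((hA b).mpr (((hA a).mp ha).tail hab))⟩
  · exact ⟨w, B, exists_spans_of_reflTransGen (fun a b h => h.1.symm) w B hB, by omega, Or.inr
      fun a ha b hb hab => hb ((hB b).mpr (((hB a).mp ha).tail hab))⟩

theorem dirAdj_iff {G : SimpleGraph (Fin n)} {f : G.edgeSet → Bool} {a b : Fin n}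
    (h : G.Adj a b) : dirAdj G f a b ↔ f ⟨s(a, b), h⟩ = decide (a < b) :=
  ⟨fun ⟨_, h⟩ => h, fun h' => ⟨h, h'⟩⟩

theorem dirAdj_swap_iff {G : SimpleGraph (Fin n)} {f : G.edgeSet → Bool} {a b : Fin n}
    (h : G.Adj a b) : dirAdj G f b a ↔ ¬ f ⟨s(a, b), h⟩ = decide (a < b) := by
  rw [dirAdj_iff h.symm]
  have he : (⟨s(b, a), h.symm⟩ : G.edgeSet) = ⟨s(a, b), h⟩ := Subtype.ext Sym2.eq_swap
  rw [he]
  have : decide (b < a) = !decide (a < b) := by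
    rcases lt_or_gt_of_ne h.ne with h | h <;> simp [h, h.le]
  rw [this]
  cases f ⟨s(a, b), h⟩ <;> cases decide (a < b) <;> simp

theorem card_orientations_le (G : SimpleGraph (Fin n)) [DecidableRel G.Adj] (S : Finset (Fin n))
    (X : Finset (G.edgeSet → Bool))
    (h : ∀ f ∈ X, ∀ g ∈ X, ∀ a ∈ S, ∀ b ∉ S, ∀ hab : G.Adj a b,
      f ⟨s(a, b), hab⟩ = g ⟨s(a, b), hab⟩) :
    (#X : ℝ) ≤ (1 / 2) ^ #(edgeBoundary G S) * (Fintype.card (G.edgeSet → Bool) : ℝ) := by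
  have hsub : ∀ e ∈ edgeBoundary G S, e ∈ G.edgeSet := fun e he => by
    obtain ⟨a, b, -, -, hab, rfl⟩ := mem_edgeBoundary.mp he
    exact hab
  have hcard : #((edgeBoundary G S).subtype (· ∈ G.edgeSet)) = #(edgeBoundary G S) := by
    rw [card_subtype, filter_true_of_mem hsub]
  rw [← hcard]
  refine card_mul_two_pow_le_of_agree X _ fun f hf g hg e he => ?_
  obtain ⟨e, he'⟩ := e
  obtain ⟨a, b, ha, hb, hab, rfl⟩ := mem_edgeBoundary.mp (mem_subtype.mp he)
  exact h f hf g hg a ha b hb hab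

theorem card_no_arc_leaving_or_entering_le (G : SimpleGraph (Fin n)) [DecidableRel G.Adj]
    (S : Finset (Fin n)) (X : Finset (G.edgeSet → Bool))
    (h : ∀ f ∈ X, (∀ a ∈ S, ∀ b ∉ S, ¬ dirAdj G f a b) ∨ ∀ a ∈ S, ∀ b ∉ S, ¬ dirAdj G f b a) :
    (#X : ℝ) ≤
      2 * (1 / 2) ^ #(edgeBoundary G S) * (Fintype.card (G.edgeSet → Bool) : ℝ) := by
  classical
  have h1 := card_orientations_le G S
    (X.filter fun f => ∀ a ∈ S, ∀ b ∉ S, ¬ dirAdj G f a b) fun f hf g hg a ha b hb hab => by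
      have hf := (mem_filter.mp hf).2 a ha b hb
      have hg := (mem_filter.mp hg).2 a ha b hb
      rw [dirAdj_iff hab, ← ne_eq, ← Bool.eq_not] at hf hg
      rw [hf, hg]
  have h2 := card_orientations_le G S
    (X.filter fun f => ∀ a ∈ S, ∀ b ∉ S, ¬ dirAdj G f b a) fun f hf g hg a ha b hb hab => by
      have hf := (mem_filter.mp hf).2 a ha b hb
      have hg := (mem_filter.mp hg).2 a ha b hb
      rw [dirAdj_swap_iff hab, not_not] at hf hg
      rw [hf, hg]
  have hsub : X ⊆ (X.filter fun f => ∀ a ∈ S, ∀ b ∉ S, ¬ dirAdj G f a b) ∪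
      X.filter fun f => ∀ a ∈ S, ∀ b ∉ S, ¬ dirAdj G f b a := fun f hf => by
    rw [← filter_or]
    exact mem_filter.mpr ⟨hf, h f hf⟩
  have h3 : (#X : ℝ) ≤ #(X.filter fun f => ∀ a ∈ S, ∀ b ∉ S, ¬ dirAdj G f a b) +
      #(X.filter fun f => ∀ a ∈ S, ∀ b ∉ S, ¬ dirAdj G f b a) := by
    exact_mod_cast (card_le_card hsub).trans (card_union_le _ _)
  linarith

/-- If all small-volume sets have edge boundary at least eight times their size, a random
orientation is strongly connected up to probability `4 * n * 2 ^ (-D)`. -/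
theorem one_sub_le_orientProb (G : SimpleGraph (Fin n)) [DecidableRel G.Adj] {D : ℝ}
    (hD : 19 ≤ D) (hdeg : ∀ v, D ≤ G.degree v)
    (hbd : ∀ S : Finset (Fin n), 2 * ∑ u ∈ S, G.degree u ≤ ∑ u, G.degree u →
      8 * (#S : ℝ) ≤ #(edgeBoundary G S)) :
    1 - 4 * (n * 2 ^ (-D)) ≤ orientProb G (IsStronglyConnected G) := by
  classical
  set N : ℝ := (Fintype.card (G.edgeSet → Bool) : ℝ) with hN
  have hNpos : 0 < N := by rw [hN]; exact_mod_cast Fintype.card_pos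
  let 𝒮 : Fin n → Finset (Finset (Fin n)) := fun v => univ.filter fun S =>
    (∃ T, Spans G v S T) ∧ 2 * ∑ u ∈ S, G.degree u ≤ ∑ u, G.degree u
  let X : Finset (Fin n) → Finset (G.edgeSet → Bool) := fun S => univ.filter fun f =>
    (∀ a ∈ S, ∀ b ∉ S, ¬ dirAdj G f a b) ∨ ∀ a ∈ S, ∀ b ∉ S, ¬ dirAdj G f b a
  have hfail : (#(univ.filter fun f => ¬ IsStronglyConnected G f) : ℝ) ≤
      4 * (n * 2 ^ (-D)) * N := by
    have hsub : (univ.filter fun f => ¬ IsStronglyConnected G f) ⊆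
        univ.biUnion fun v => (𝒮 v).biUnion X := by
      intro f hf
      obtain ⟨v, S, hT, hvol, hcut⟩ :=
        exists_spans_of_not_isStronglyConnected G f (mem_filter.mp hf).2
      simp only [mem_biUnion, mem_univ, true_and]
      exact ⟨v, S, mem_filter.mpr ⟨mem_univ _, hT, hvol⟩, mem_filter.mpr ⟨mem_univ _, hcut⟩⟩
    have h1 : #(univ.filter fun f => ¬ IsStronglyConnected G f) ≤ ∑ v, ∑ S ∈ 𝒮 v, #(X S) :=
      (card_le_card hsub).trans
        (card_biUnion_le.trans (sum_le_sum fun v _ => card_biUnion_le))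
    calc (#(univ.filter fun f => ¬ IsStronglyConnected G f) : ℝ)
        ≤ ∑ v, ∑ S ∈ 𝒮 v, (#(X S) : ℝ) := by exact_mod_cast h1
      _ ≤ ∑ v, ∑ S ∈ 𝒮 v, 2 * (1 / 2) ^ #(edgeBoundary G S) * N :=
          sum_le_sum fun v _ => sum_le_sum fun S _ =>
            card_no_arc_leaving_or_entering_le G S (X S) fun f hf => (mem_filter.mp hf).2
      _ = ∑ v, (∑ S ∈ 𝒮 v, (1 / 2) ^ #(edgeBoundary G S)) * (2 * N) := by
          refine sum_congr rfl fun v _ => ?_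
          rw [sum_mul]
          exact sum_congr rfl fun S _ => by ring
      _ ≤ ∑ _v : Fin n, 2 * 2 ^ (-D) * (2 * N) := by
          refine sum_le_sum fun v _ => mul_le_mul_of_nonneg_right ?_ (by positivity)
          exact sum_half_pow_edgeBoundary_le G hD hdeg v _
            (fun S hS => (mem_filter.mp hS).2.1) fun S hS => hbd S (mem_filter.mp hS).2.2
      _ = 4 * (n * 2 ^ (-D)) * N := by
          rw [sum_const, card_univ, Fintype.card_fin, nsmul_eq_mul]
          ring
  have hsplit : (#(univ.filter fun f => IsStronglyConnected G f) : ℝ) +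
      #(univ.filter fun f => ¬ IsStronglyConnected G f) = N := by
    rw [hN, ← card_univ]
    exact_mod_cast card_filter_add_card_filter_not _
  have hprob : orientProb G (IsStronglyConnected G) =
      (#(univ.filter fun f => IsStronglyConnected G f) : ℝ) / N := by
    unfold orientProb
    congr!
  rw [hprob, le_div_iff₀ hNpos]
  linarith

/-- **Corollary 1.2.** The Cheeger-constant hypothesis in Theorem 1.1 may be replaced by
`λ₁/2 > ξ·log₂log₂ n / log₂ n`, where `λ₁` is the second-smallest eigenvalue of the
normalized Laplacian of `G`. -/
theorem random_orientation_strongly_connected_whp_spectral (α ξ : ℝ)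
    (hα : 0 < α) (hξ : 4 < ξ) :
    ∃ N₀ : ℕ, ∀ n : ℕ, N₀ ≤ n → ∀ (G : SimpleGraph (Fin n)) [DecidableRel G.Adj],
      (∀ v : Fin n, (1 + α) * Real.logb 2 n ≤ (G.degree v : ℝ)) →
      ∀ hH : (normLap G).IsHermitian,
      ξ * (Real.logb 2 (Real.logb 2 n) / Real.logb 2 n) <
        (sortedEigenvalues hH).getD 1 0 / 2 →
      1 - (1 + 4 * α * Real.logb 2 n) / (α * (n : ℝ) ^ α * Real.logb 2 n) ≤
        orientProb G (IsStronglyConnected G) := by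
  refine ⟨2 ^ 19, fun n hn G _ hdeg hH hgap => ?_⟩
  set L := Real.logb 2 n with hL
  have hn' : (2 : ℝ) ^ (19 : ℕ) ≤ n := by exact_mod_cast hn
  have hn0 : (0 : ℝ) < n := lt_of_lt_of_le (by positivity) hn'
  have hL19 : 19 ≤ L := by
    rw [hL, Real.le_logb_iff_rpow_le (by norm_num) hn0]
    exact_mod_cast hn'
  have hLL : 2 ≤ Real.logb 2 L := by
    rw [Real.le_logb_iff_rpow_le (by norm_num) (by linarith)]
    norm_num
    linarith
  have hD : 19 ≤ (1 + α) * L := by nlinarith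
  have hpos : ∀ v, 0 < G.degree v := fun v => by
    have := hdeg v
    exact_mod_cast (show (0 : ℝ) < G.degree v by linarith)
  have hbd : ∀ S : Finset (Fin n), 2 * ∑ u ∈ S, G.degree u ≤ ∑ u, G.degree u →
      8 * (#S : ℝ) ≤ #(edgeBoundary G S) := by
    intro S hS
    have h8 : 8 / L ≤ (sortedEigenvalues hH).getD 1 0 / 2 := by
      refine le_trans ?_ hgap.le
      rw [← mul_div_assoc]
      gcongr
      nlinarith
    have h8L : 0 < 8 / L := by positivity
    have hcheeger := half_eigenvalue_mul_vol_le G (le_trans (by norm_num) hn) hpos hH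
      (by linarith) S hS
    refine le_trans ?_ hcheeger
    have hvol : #S * L ≤ ∑ v ∈ S, (G.degree v : ℝ) := by
      rw [← nsmul_eq_mul]
      exact card_nsmul_le_sum _ _ _ fun v _ => le_trans (by nlinarith) (hdeg v)
    calc 8 * (#S : ℝ) = 8 / L * (#S * L) := by field_simp
      _ ≤ _ := mul_le_mul h8 hvol (by positivity) (h8L.le.trans h8)
  refine le_trans ?_ (one_sub_le_orientProb G hD hdeg hbd)
  have hpow : (n : ℝ) * 2 ^ (-((1 + α) * L)) = ((n : ℝ) ^ α)⁻¹ := by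
    have h2 : (2 : ℝ) ^ L = n := Real.rpow_logb (by norm_num) (by norm_num) hn0
    rw [show -((1 + α) * L) = L * (-(1 + α)) by ring, Real.rpow_mul (by norm_num), h2,
      ← Real.rpow_neg hn0.le]
    nth_rewrite 1 [← Real.rpow_one (n : ℝ)]
    rw [← Real.rpow_add hn0]
    congr 1
    ring
  have hnα : 0 < (n : ℝ) ^ α := Real.rpow_pos_of_pos hn0 α
  have hL0 : 0 < L := by linarith
  rw [hpow, sub_le_sub_iff_left, ← div_eq_mul_inv, div_le_div_iff₀ hnα (by positivity)]
  nlinarith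
end

section
/- Let α > 0 be real. There exists N₀ = N₀(α) such that for all n ≥ N₀ the following holds: if G is a finite simple graph on n vertices with minimum degree δ(G) ≥ (1+α)·log₂ n, then the probability (over a uniformly random orientation of G) that there exists a set X of at most (α/2)·log₂ n vertices which induces a connected subgraph of G, satisfies vol(X) ≤ vol(G)/2, and in the orientation has either no edge directed from its complement into X or no edge directed from X into its complement, is strictly less than 4·n^{−α}. -/
open Finset

variable {n : ℕ}

/-- No edge of the orientation is directed from the complement of `X` into `X`. -/
def NoEdgeIn (G : SimpleGraph (Fin n)) (f : G.edgeSet → Bool) (X : Finset (Fin n)) : Prop :=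
  ∀ u v : Fin n, u ∉ X → v ∈ X → ¬ dirAdj G f u v

/-- No edge of the orientation is directed from `X` into its complement. -/
def NoEdgeOut (G : SimpleGraph (Fin n)) (f : G.edgeSet → Bool) (X : Finset (Fin n)) : Prop :=
  ∀ u v : Fin n, u ∈ X → v ∉ X → ¬ dirAdj G f u v

/-- `X` induces a connected subgraph of `G`, has volume at most half of the total,
and (in the orientation `f`) has either no edge entering it or no edge leaving it. -/
def BadSet (G : SimpleGraph (Fin n)) [DecidableRel G.Adj]
    (f : G.edgeSet → Bool) (X : Finset (Fin n)) : Prop :=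
  (G.induce (X : Set (Fin n))).Connected ∧ 2 * vol G X ≤ vol G Finset.univ ∧
    (NoEdgeIn G f X ∨ NoEdgeOut G f X)

theorem card_filter_eq_comp_mul_le {ι E : Type*} [Fintype ι] [Fintype E] [DecidableEq E]
    (φ : ι → E) (hφ : Function.Injective φ) (g : ι → Bool) (s : Finset (E → Bool))
    (hs : ∀ f ∈ s, ∀ p, f (φ p) = g p) :
    s.card * 2 ^ Fintype.card ι ≤ Fintype.card (E → Bool) := by
  classical
  set S : Finset E := univ.image φ
  have hS : S.card = Fintype.card ι := by
    rw [card_image_of_injective _ hφ, card_univ]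
  have hsub : s ⊆ Fintype.piFinset
      (fun e => if e ∈ S then {Function.extend φ g (fun _ => false) e} else univ) := by
    intro f hf
    rw [Fintype.mem_piFinset]
    intro e
    split_ifs with he
    · obtain ⟨p, -, rfl⟩ := mem_image.mp he
      simp [hφ.extend_apply, hs f hf p]
    · exact mem_univ _
  have hcard := card_le_card hsub
  rw [Fintype.card_piFinset] at hcard
  have hprod : (∏ e : E, (if e ∈ S then {Function.extend φ g (fun _ => false) e}
      else (univ : Finset Bool)).card) = 2 ^ Sᶜ.card := by
    rw [← prod_const, ← prod_mul_prod_compl S, prod_eq_one, one_mul]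
    · refine prod_congr rfl fun e he => ?_
      simp [mem_compl.mp he]
    · intro e he
      simp [he]
  rw [hprod] at hcard
  calc s.card * 2 ^ Fintype.card ι ≤ 2 ^ Sᶜ.card * 2 ^ S.card := by
        rw [hS]; gcongr
    _ = Fintype.card (E → Bool) := by
        rw [← pow_add, card_compl_add_card]; simp

theorem orientProb_le_sum (G : SimpleGraph (Fin n)) [DecidableRel G.Adj] {κ : Type*}
    (A : Finset κ) (P : (G.edgeSet → Bool) → Prop) (Q : κ → (G.edgeSet → Bool) → Prop)
    (h : ∀ f, P f → ∃ a ∈ A, Q a f) : orientProb G P ≤ ∑ a ∈ A, orientProb G (Q a) := by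
  classical
  unfold orientProb
  rw [← sum_div]
  gcongr
  rw [← Nat.cast_sum, Nat.cast_le]
  refine le_trans (card_le_card fun f hf => ?_) card_biUnion_le
  obtain ⟨a, ha, hQ⟩ := h f (mem_filter.mp hf).2
  exact mem_biUnion.mpr ⟨a, ha, mem_filter.mpr ⟨mem_univ _, hQ⟩⟩

/-- The pairs `(u, v)` of adjacent vertices with `u ∈ X` and `v ∉ X`. -/
abbrev Cut (G : SimpleGraph (Fin n)) [DecidableRel G.Adj] (X : Finset (Fin n)) : Type :=
  (u : X) × {v : Fin n // v ∈ G.neighborFinset u \ X}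

/-- The edge underlying a pair in the cut. -/
def cutEdge (G : SimpleGraph (Fin n)) [DecidableRel G.Adj] (X : Finset (Fin n))
    (p : Cut G X) : G.edgeSet :=
  ⟨s(p.1.1, p.2.1), (SimpleGraph.mem_edgeSet G).mpr
    ((G.mem_neighborFinset _ _).mp (mem_sdiff.mp p.2.2).1)⟩

theorem cutEdge_injective (G : SimpleGraph (Fin n)) [DecidableRel G.Adj]
    (X : Finset (Fin n)) : Function.Injective (cutEdge G X) := by
  rintro ⟨⟨u, hu⟩, ⟨v, hv⟩⟩ ⟨⟨u', hu'⟩, ⟨v', hv'⟩⟩ h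
  have h' : s(u, v) = s(u', v') := congrArg Subtype.val h
  rcases Sym2.eq_iff.mp h' with ⟨rfl, rfl⟩ | ⟨rfl, rfl⟩
  · rfl
  · exact absurd hu' (mem_sdiff.mp hv).2

theorem mul_sub_le_card_cut (G : SimpleGraph (Fin n)) [DecidableRel G.Adj]
    (X : Finset (Fin n)) {D : ℝ} (hD : ∀ v, D ≤ (G.degree v : ℝ)) :
    (X.card : ℝ) * (D - (X.card - 1)) ≤ Fintype.card (Cut G X) := by
  have hv : ∀ u : X, D - ((X.card : ℝ) - 1) ≤ ((G.neighborFinset u \ X).card : ℝ) := by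
    intro u
    have h1 : (G.neighborFinset u ∩ X).card ≤ (X.erase u).card := by
      refine card_le_card fun v hv => ?_
      obtain ⟨h, hX⟩ := mem_inter.mp hv
      exact mem_erase.mpr ⟨((G.mem_neighborFinset _ _).mp h).ne', hX⟩
    have h2 := card_erase_add_one u.2
    have h3 := card_sdiff_add_card_inter (G.neighborFinset u) X
    rw [G.card_neighborFinset_eq_degree] at h3
    have h4 : (G.degree u : ℝ) + 1 ≤ ((G.neighborFinset u \ X).card : ℝ) + X.card := by
      exact_mod_cast (by omega)
    linarith [hD u]
  simp only [Fintype.card_sigma, Fintype.card_coe, Nat.cast_sum]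
  have h := card_nsmul_le_sum univ _ _ fun (u : X) (_ : u ∈ univ) => hv u
  rwa [card_univ, Fintype.card_coe, nsmul_eq_mul] at h

theorem orientProb_le_of_cut_determined (G : SimpleGraph (Fin n)) [DecidableRel G.Adj]
    (X : Finset (Fin n)) {D : ℝ} (hD : ∀ v, D ≤ (G.degree v : ℝ))
    (P : (G.edgeSet → Bool) → Prop) (g : Cut G X → Bool)
    (hP : ∀ f, P f → ∀ p, f (cutEdge G X p) = g p) :
    orientProb G P ≤ (2 : ℝ) ^ (-((X.card : ℝ) * (D - (X.card - 1)))) := by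
  classical
  have h := card_filter_eq_comp_mul_le (cutEdge G X) (cutEdge_injective G X) g
    (@Finset.filter _ P (Classical.decPred _) Finset.univ)
    (fun f hf => hP f (mem_filter.mp hf).2)
  calc orientProb G P ≤ (2 : ℝ) ^ (-(Fintype.card (Cut G X) : ℝ)) := by
        unfold orientProb
        rw [Real.rpow_neg (by norm_num), Real.rpow_natCast,
          div_le_iff₀ (by exact_mod_cast Fintype.card_pos), ← div_eq_inv_mul,
          le_div_iff₀ (by positivity)]
        exact_mod_cast h
    _ ≤ _ := Real.rpow_le_rpow_of_exponent_le (by norm_num)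
        (neg_le_neg (mul_sub_le_card_cut G X hD))

theorem orientProb_badSet_le (G : SimpleGraph (Fin n)) [DecidableRel G.Adj]
    (X : Finset (Fin n)) {D : ℝ} (hD : ∀ v, D ≤ (G.degree v : ℝ)) :
    orientProb G (fun f => BadSet G f X) ≤
      2 * (2 : ℝ) ^ (-((X.card : ℝ) * (D - (X.card - 1)))) := by
  have hin := orientProb_le_of_cut_determined G X hD (fun f => NoEdgeIn G f X)
    (fun p => !decide (p.2.1 < p.1.1)) (by
      intro f hf p
      have hv := mem_sdiff.mp p.2.2
      have := hf _ _ hv.2 p.1.2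
      have hadj := (G.mem_neighborFinset _ _).mp hv.1
      rw [Bool.eq_not]
      intro h
      refine this ⟨hadj.symm, ?_⟩
      rw [← h]
      congr 1
      exact Subtype.ext Sym2.eq_swap)
  have hout := orientProb_le_of_cut_determined G X hD (fun f => NoEdgeOut G f X)
    (fun p => !decide (p.1.1 < p.2.1)) (by
      intro f hf p
      have hv := mem_sdiff.mp p.2.2
      rw [Bool.eq_not]
      exact fun h => hf _ _ p.1.2 hv.2 ⟨(G.mem_neighborFinset _ _).mp hv.1, h⟩)
  have hunion := orientProb_le_sum G (univ : Finset Bool) (fun f => BadSet G f X)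
    (fun b f => if b then NoEdgeIn G f X else NoEdgeOut G f X) (by
      rintro f ⟨-, -, h | h⟩
      · exact ⟨true, mem_univ _, by simpa using h⟩
      · exact ⟨false, mem_univ _, by simpa using h⟩)
  simp only [Fintype.sum_bool, if_true, Bool.false_eq_true, if_false] at hunion
  linarith

theorem sum_range_half_pow_lt_two (K : ℕ) : ∑ j ∈ range K, (1 / 2 : ℝ) ^ j < 2 := by
  rw [geom_sum_eq (by norm_num), div_lt_iff_of_neg (by norm_num)]
  have : (0 : ℝ) < (1 / 2) ^ K := by positivity
  linarith

theorem choose_mul_rpow_le {α L : ℝ} {n j : ℕ} (hn : (n : ℝ) = 2 ^ L) (hL : 2 < α * L)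
    (hj : (j : ℝ) + 1 ≤ α / 2 * L) :
    (n.choose (j + 1) : ℝ) *
      (2 : ℝ) ^ (-(((j + 1 : ℕ) : ℝ) * ((1 + α) * L - (((j + 1 : ℕ) : ℝ) - 1)))) ≤
      (n : ℝ) ^ (-α) * (1 / 2) ^ j := by
  have hc : (n.choose (j + 1) : ℝ) ≤ (2 : ℝ) ^ (L * (j + 1)) := by
    rw [Real.rpow_mul (by norm_num), ← hn]
    exact_mod_cast Nat.choose_le_pow n (j + 1)
  have hr : (n : ℝ) ^ (-α) * (1 / 2) ^ j = (2 : ℝ) ^ (L * (-α) + -(j : ℝ)) := by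
    rw [Real.rpow_add (by norm_num), Real.rpow_mul (by norm_num), ← hn,
      Real.rpow_neg (by norm_num) (j : ℝ), Real.rpow_natCast, one_div, inv_pow]
  rw [hr]
  refine (mul_le_mul_of_nonneg_right hc (by positivity)).trans ?_
  rw [← Real.rpow_add (by norm_num)]
  refine Real.rpow_le_rpow_of_exponent_le (by norm_num) ?_
  push_cast
  have hj0 : (0 : ℝ) ≤ j := j.cast_nonneg
  nlinarith [mul_le_mul_of_nonneg_left hj hj0, mul_le_mul_of_nonneg_left hL.le hj0]

/-- **Regime 1.** If `G` has minimum degree at least `(1+α)·log₂ n` and `n` is large,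
the probability that some connected set of at most `(α/2)·log₂ n` vertices of at most
half the total volume has no edge in or no edge out is less than `4·n^{−α}`. -/
theorem small_bad_sets_unlikely (α : ℝ) (hα : 0 < α) :
    ∃ N₀ : ℕ, ∀ n : ℕ, N₀ ≤ n → ∀ (G : SimpleGraph (Fin n)) [DecidableRel G.Adj],
      (∀ v : Fin n, (1 + α) * Real.logb 2 n ≤ (G.degree v : ℝ)) →
      orientProb G (fun f => ∃ X : Finset (Fin n),
          (X.card : ℝ) ≤ α / 2 * Real.logb 2 n ∧ BadSet G f X) <
        4 * (n : ℝ) ^ (-α) := by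
  have hlog : Filter.Tendsto (fun n : ℕ => Real.logb 2 (n : ℝ)) Filter.atTop Filter.atTop :=
    (Real.tendsto_logb_atTop (by norm_num)).comp tendsto_natCast_atTop_atTop
  obtain ⟨N₀, hN₀⟩ := Filter.eventually_atTop.mp
    ((hlog.eventually_gt_atTop (2 / α)).and (Filter.eventually_gt_atTop 0))
  refine ⟨N₀, fun n hn G _ hdeg => ?_⟩
  obtain ⟨hL, hn0⟩ := hN₀ n hn
  have hn0' : (0 : ℝ) < n := by exact_mod_cast hn0
  set L := Real.logb 2 (n : ℝ)
  have hnL : (n : ℝ) = 2 ^ L := (Real.rpow_logb (by norm_num) (by norm_num) hn0').symm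
  have hL' : 2 < α * L := by rwa [div_lt_iff₀' hα] at hL
  set K := ⌊α / 2 * L⌋₊
  have hK : (K : ℝ) ≤ α / 2 * L := Nat.floor_le (by linarith)
  have hunion := orientProb_le_sum G
    ((range K).sigma fun j => powersetCard (j + 1) (univ : Finset (Fin n)))
    (fun f => ∃ X : Finset (Fin n), (X.card : ℝ) ≤ α / 2 * L ∧ BadSet G f X)
    (fun p f => BadSet G f p.2) (by
      rintro f ⟨X, hX, hbad⟩
      have hne : X.Nonempty := by
        obtain ⟨⟨x, hx⟩⟩ := hbad.1.nonempty
        exact ⟨x, by simpa using hx⟩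
      have hpos := hne.card_pos
      have hle : X.card ≤ K := Nat.le_floor hX
      refine ⟨⟨X.card - 1, X⟩, mem_sigma.mpr ⟨mem_range.mpr (Nat.sub_one_lt_of_le hpos hle), ?_⟩, hbad⟩
      exact mem_powersetCard.mpr ⟨subset_univ _, (Nat.sub_add_cancel hpos).symm⟩)
  rw [sum_sigma] at hunion
  calc _ ≤ _ := hunion
    _ ≤ ∑ j ∈ range K, 2 * ((n : ℝ) ^ (-α) * (1 / 2) ^ j) := by
        refine sum_le_sum fun j hj => ?_
        have hjK : (j : ℝ) + 1 ≤ α / 2 * L :=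
          le_trans (by exact_mod_cast mem_range.mp hj) hK
        have hX : ∀ X ∈ powersetCard (j + 1) (univ : Finset (Fin n)),
            orientProb G (fun f => BadSet G f X) ≤ 2 * (2 : ℝ) ^
              (-(((j + 1 : ℕ) : ℝ) * ((1 + α) * L - (((j + 1 : ℕ) : ℝ) - 1)))) := by
          intro X hX
          have h := orientProb_badSet_le G X hdeg
          rwa [(mem_powersetCard.mp hX).2] at h
        have hsum := sum_le_card_nsmul _ _ _ hX
        rw [card_powersetCard, card_univ, Fintype.card_fin, nsmul_eq_mul] at hsum
        linarith [choose_mul_rpow_le hnL hL' hjK]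
    _ = 2 * (n : ℝ) ^ (-α) * ∑ j ∈ range K, (1 / 2 : ℝ) ^ j := by
        rw [mul_sum]
        exact sum_congr rfl fun j _ => by ring
    _ < 2 * (n : ℝ) ^ (-α) * 2 := by
        gcongr
        exact sum_range_half_pow_lt_two K
    _ = 4 * (n : ℝ) ^ (-α) := by ring
end

section
/- Let α > 0 and ξ > 4 be real numbers. There exists N₀ = N₀(α, ξ) such that for all n ≥ N₀ the following holds: if G is a finite simple graph on n vertices with minimum degree δ(G) ≥ (1+α)·log₂ n and Cheeger constant Φ(G) > ξ·(log₂ log₂ n)/(log₂ n), then Σ over integers k with (α/2)·log₂ n ≤ k ≤ n of P(B_k) is at most 1/(α·n^α·log₂ n), where B_k is the event (over a uniformly random orientation of G) that there exists a set X of exactly k vertices which induces a connected subgraph of G, satisfies vol(X) ≤ vol(G)/2, and in the orientation has either no edge directed from its complement into X or no edge directed from X into its complement. -/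
open Finset

variable {n : ℕ}

/-- The vertices outside `X` with a neighbour in `X`. -/
noncomputable def vertexBoundary (G : SimpleGraph (Fin n)) (X : Finset (Fin n)) :
    Finset (Fin n) :=
  open Classical in univ.filter fun w => w ∉ X ∧ ∃ u ∈ X, G.Adj u w

lemma mem_vertexBoundary {G : SimpleGraph (Fin n)} {X : Finset (Fin n)} {w : Fin n} :
    w ∈ vertexBoundary G X ↔ w ∉ X ∧ ∃ u ∈ X, G.Adj u w := by
  simp [vertexBoundary]

lemma card_vertexBoundary_le_crossCount (G : SimpleGraph (Fin n)) [DecidableRel G.Adj]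
    (X : Finset (Fin n)) : (vertexBoundary G X).card ≤ crossCount G X := by
  classical
  refine le_trans (card_le_card ?_) (card_image_le (f := Prod.snd))
  intro w hw
  obtain ⟨hwX, u, hu, huw⟩ := mem_vertexBoundary.mp hw
  exact mem_image.mpr ⟨(u, w), by simp [hu, hwX, huw], rfl⟩

/-- The Bernoulli weight of all configurations that contain `X` and avoid `Y`. -/
lemma sum_Icc_compl_weight {X Y : Finset (Fin n)} (h : Disjoint X Y) {p q : ℝ}
    (hpq : p + q = 1) :
    ∑ S ∈ Icc X Yᶜ, p ^ S.card * q ^ (n - S.card) = p ^ X.card * q ^ Y.card := by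
  have hXY : X ⊆ Yᶜ := subset_compl_iff_disjoint_right.mpr h
  have hcardY : Y.card + (Yᶜ).card = n := by simp
  have hcard : (Yᶜ \ X).card + X.card = (Yᶜ).card := card_sdiff_add_card_eq_card hXY
  rw [Icc_eq_image_powerset hXY, sum_image]
  · have key : ∀ T ∈ (Yᶜ \ X).powerset,
        p ^ (X ∪ T).card * q ^ (n - (X ∪ T).card) =
          p ^ X.card * q ^ Y.card * (p ^ T.card * q ^ ((Yᶜ \ X).card - T.card)) := by
      intro T hT
      have hT' := mem_powerset.mp hT
      have hdisj : Disjoint X T := disjoint_sdiff.mono_right hT'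
      have hTc := card_le_card hT'
      rw [card_union_of_disjoint hdisj,
        show n - (X.card + T.card) = Y.card + ((Yᶜ \ X).card - T.card) by omega, pow_add, pow_add]
      ring
    rw [sum_congr rfl key, ← mul_sum, sum_pow_mul_eq_add_pow, hpq, one_pow, mul_one]
  · intro T hT T' hT' hTT'
    have h1 : Disjoint X T := disjoint_sdiff.mono_right (mem_powerset.mp hT)
    have h2 : Disjoint X T' := disjoint_sdiff.mono_right (mem_powerset.mp hT')
    have h3 : (X ∪ T) \ X = (X ∪ T') \ X := congrArg (· \ X) hTT'
    rwa [union_sdiff_cancel_left h1, union_sdiff_cancel_left h2] at h3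

/-- A connected set meeting `X` and avoiding its vertex boundary lies inside `X`. -/
lemma subset_of_connected_of_disjoint_vertexBoundary {G : SimpleGraph (Fin n)}
    {X Z : Finset (Fin n)} {v : Fin n} (hvX : v ∈ X) (hvZ : v ∈ Z)
    (hZ : (G.induce (Z : Set (Fin n))).Connected) (hdisj : Disjoint Z (vertexBoundary G X)) :
    Z ⊆ X := by
  intro w hw
  by_contra hwX
  obtain ⟨walk⟩ := hZ.preconnected ⟨v, hvZ⟩ ⟨w, hw⟩
  obtain ⟨d, -, hd1, hd2⟩ := walk.exists_boundary_dart {x | (x : Fin n) ∈ X} hvX hwX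
  exact disjoint_left.mp hdisj d.snd.2
    (mem_vertexBoundary.mpr ⟨hd2, d.fst, hd1, d.adj⟩)

/-- The cluster of `v` in site percolation is a well-defined random set, so the probabilities
of its possible values sum to at most one. -/
lemma sum_connected_weight_le_one (G : SimpleGraph (Fin n)) {p q : ℝ} (hp : 0 ≤ p) (hq : 0 ≤ q)
    (hpq : p + q = 1) (v : Fin n) (F : Finset (Finset (Fin n)))
    (hF : ∀ X ∈ F, v ∈ X ∧ (G.induce (X : Set (Fin n))).Connected) :
    ∑ X ∈ F, p ^ X.card * q ^ (vertexBoundary G X).card ≤ 1 := by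
  have hdisj : ∀ X : Finset (Fin n), Disjoint X (vertexBoundary G X) := fun X =>
    disjoint_left.mpr fun w hw hw' => (mem_vertexBoundary.mp hw').1 hw
  rw [sum_congr rfl fun X _ => (sum_Icc_compl_weight (hdisj X) hpq).symm, ← sum_biUnion]
  · refine (sum_le_sum_of_subset_of_nonneg (subset_univ _) fun _ _ _ => by positivity).trans ?_
    have h := sum_pow_mul_eq_add_pow p q (univ : Finset (Fin n))
    rw [powerset_univ, card_univ, Fintype.card_fin, hpq, one_pow] at h
    exact h.le
  · intro X hX Z hZ hne
    refine disjoint_left.mpr fun S hSX hSZ => hne ?_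
    obtain ⟨hX1, hX2⟩ := mem_Icc.mp hSX
    obtain ⟨hZ1, hZ2⟩ := mem_Icc.mp hSZ
    have hX3 := subset_compl_iff_disjoint_right.mp hX2
    have hZ3 := subset_compl_iff_disjoint_right.mp hZ2
    obtain ⟨hvX, hXc⟩ := hF X hX
    obtain ⟨hvZ, hZc⟩ := hF Z hZ
    exact Subset.antisymm
      (subset_of_connected_of_disjoint_vertexBoundary hvZ hvX hXc (hZ3.mono_left hX1))
      (subset_of_connected_of_disjoint_vertexBoundary hvX hvZ hZc (hX3.mono_left hZ1))

lemma sum_connected_weight_le (G : SimpleGraph (Fin n)) {p q : ℝ} (hp : 0 ≤ p) (hq : 0 ≤ q)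
    (hpq : p + q = 1) (F : Finset (Finset (Fin n)))
    (hF : ∀ X ∈ F, (G.induce (X : Set (Fin n))).Connected) :
    ∑ X ∈ F, p ^ X.card * q ^ (vertexBoundary G X).card ≤ n := by
  calc ∑ X ∈ F, p ^ X.card * q ^ (vertexBoundary G X).card
      ≤ ∑ X ∈ F, ∑ v : Fin n,
          if v ∈ X then p ^ X.card * q ^ (vertexBoundary G X).card else 0 := by
        refine sum_le_sum fun X hX => ?_
        obtain ⟨v, hv⟩ := (hF X hX).nonempty
        refine le_trans (if_pos (mem_coe.mp hv)).ge (single_le_sum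
          (f := fun v => if v ∈ X then p ^ X.card * q ^ (vertexBoundary G X).card else 0)
          (fun _ _ => ?_) (mem_univ v))
        positivity
    _ = ∑ v : Fin n, ∑ X ∈ F.filter (v ∈ ·), p ^ X.card * q ^ (vertexBoundary G X).card := by
        rw [sum_comm]
        simp_rw [sum_filter]
    _ ≤ ∑ _v : Fin n, (1 : ℝ) := sum_le_sum fun v _ =>
        sum_connected_weight_le_one G hp hq hpq v _ fun X hX =>
          ⟨(mem_filter.mp hX).2, hF X (mem_filter.mp hX).1⟩
    _ = n := by simp

section Probability

variable (G : SimpleGraph (Fin n)) [DecidableRel G.Adj]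

lemma orientProb_mono {P Q : (G.edgeSet → Bool) → Prop} (h : ∀ f, P f → Q f) :
    orientProb G P ≤ orientProb G Q := by
  classical
  unfold orientProb
  gcongr with f
  exact h f

lemma orientProb_or_le (P Q : (G.edgeSet → Bool) → Prop) :
    orientProb G (fun f => P f ∨ Q f) ≤ orientProb G P + orientProb G Q := by
  classical
  unfold orientProb
  rw [← add_div]
  gcongr
  norm_cast
  refine (card_le_card ?_).trans (card_union_le _ _)
  intro f
  simp

lemma orientProb_exists_mem_le {ι : Type*} (F : Finset ι) (P : ι → (G.edgeSet → Bool) → Prop) :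
    orientProb G (fun f => ∃ i ∈ F, P i f) ≤ ∑ i ∈ F, orientProb G (P i) := by
  classical
  unfold orientProb
  rw [← sum_div]
  gcongr
  norm_cast
  refine (card_le_card ?_).trans card_biUnion_le
  intro f
  simp

/-- An event which determines the orientation on the edges of `C` has probability at most
`2 ^ (-|C|)`. -/
lemma orientProb_le_of_determined (P : (G.edgeSet → Bool) → Prop) (C : Finset G.edgeSet)
    (h : ∀ f g, P f → P g → ∀ e ∈ C, f e = g e) :
    orientProb G P ≤ (1 / 2) ^ C.card := by
  classical
  by_cases hP : ∃ g, P g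
  · obtain ⟨g, hg⟩ := hP
    have hcard : (Fintype.piFinset fun e => if e ∈ C then {g e} else (univ : Finset Bool)).card
        = 2 ^ (Cᶜ).card := by
      have : ∀ e, (if e ∈ C then {g e} else (univ : Finset Bool)).card
          = if e ∈ Cᶜ then 2 else 1 := by
        intro e
        by_cases he : e ∈ C <;> simp [he]
      rw [Fintype.card_piFinset, prod_congr rfl fun e _ => this e, prod_ite_mem, univ_inter,
        prod_const]
    have hle : (univ.filter P).card ≤ 2 ^ (Cᶜ).card := by
      rw [← hcard]
      refine card_le_card fun f hf => Fintype.mem_piFinset.mpr fun e => ?_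
      by_cases he : e ∈ C
      · simpa [he] using h f g (mem_filter.mp hf).2 hg e he
      · simp [he]
    have htot : Fintype.card (G.edgeSet → Bool) = 2 ^ C.card * 2 ^ (Cᶜ).card := by
      rw [← pow_add, card_add_card_compl, Fintype.card_fun, Fintype.card_bool]
    unfold orientProb
    rw [htot, div_le_iff₀ (by positivity)]
    push_cast
    rw [← mul_assoc, ← mul_pow]
    norm_num
    convert (Nat.cast_le (α := ℝ)).mpr hle
    simp
  · have : orientProb G P = 0 := by
      unfold orientProb
      rw [filter_false_of_mem fun f _ hf => hP ⟨f, hf⟩]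
      simp
    rw [this]
    positivity

open Classical in
/-- The edges with exactly one endpoint in `X`. -/
noncomputable def crossingEdges (X : Finset (Fin n)) : Finset G.edgeSet :=
  univ.filter fun e => ∃ u ∈ X, ∃ v ∉ X, (e : Sym2 (Fin n)) = s(u, v)

lemma crossCount_le_card_crossingEdges (X : Finset (Fin n)) :
    crossCount G X ≤ (crossingEdges G X).card := by
  refine card_le_card_of_forall_subsingleton
    (fun (p : Fin n × Fin n) (e : G.edgeSet) => (e : Sym2 (Fin n)) = s(p.1, p.2)) ?_ ?_
  · rintro ⟨u, v⟩ hp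
    simp only [mem_filter, mem_product, mem_compl] at hp
    obtain ⟨⟨hu, hv⟩, huv⟩ := hp
    exact ⟨⟨s(u, v), (SimpleGraph.mem_edgeSet G).mpr huv⟩,
      by simp only [crossingEdges, mem_filter, mem_univ, true_and]; exact ⟨u, hu, v, hv, rfl⟩, rfl⟩
  · rintro e - ⟨u, v⟩ ⟨hp, he⟩ ⟨u', v'⟩ ⟨hp', he'⟩
    simp only [mem_filter, mem_product, mem_compl] at hp hp' he he'
    rw [he, Sym2.eq_iff] at he'
    rcases he' with ⟨rfl, rfl⟩ | ⟨rfl, rfl⟩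
    · rfl
    · exact absurd hp.1.1 hp'.1.2

lemma orientProb_noEdgeIn_le (X : Finset (Fin n)) :
    orientProb G (fun f => NoEdgeIn G f X) ≤ (1 / 2) ^ crossCount G X := by
  refine (orientProb_le_of_determined G _ (crossingEdges G X) ?_).trans
    (pow_le_pow_of_le_one (by norm_num) (by norm_num) (crossCount_le_card_crossingEdges G X))
  rintro f g hf hg ⟨e, hadj⟩ he
  simp only [crossingEdges, mem_filter, mem_univ, true_and] at he
  obtain ⟨u, hu, v, hv, rfl⟩ := he
  have hvu : G.Adj v u := ((SimpleGraph.mem_edgeSet G).mp hadj).symm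
  have h1 := not_exists.mp (hf v u hv hu) hvu
  have h2 := not_exists.mp (hg v u hv hu) hvu
  have hsymm : (⟨s(v, u), (SimpleGraph.mem_edgeSet G).mpr hvu⟩ : G.edgeSet) = ⟨s(u, v), hadj⟩ :=
    Subtype.ext Sym2.eq_swap
  rw [hsymm] at h1 h2
  exact (Bool.eq_not.mpr h1).trans (Bool.eq_not.mpr h2).symm

lemma orientProb_noEdgeOut_le (X : Finset (Fin n)) :
    orientProb G (fun f => NoEdgeOut G f X) ≤ (1 / 2) ^ crossCount G X := by
  refine (orientProb_le_of_determined G _ (crossingEdges G X) ?_).trans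
    (pow_le_pow_of_le_one (by norm_num) (by norm_num) (crossCount_le_card_crossingEdges G X))
  rintro f g hf hg ⟨e, hadj⟩ he
  simp only [crossingEdges, mem_filter, mem_univ, true_and] at he
  obtain ⟨u, hu, v, hv, rfl⟩ := he
  have h1 := not_exists.mp (hf u v hu hv) hadj
  have h2 := not_exists.mp (hg u v hu hv) hadj
  exact (Bool.eq_not.mpr h1).trans (Bool.eq_not.mpr h2).symm

/-- If `4 ^ k * (2 / 3) ^ e(X, X̄) ≤ M` for all admissible `X` of size `k`, then a bad `k`-set
exists with probability at most `2 * n * M`: compare with site percolation of density `1 / 4`. -/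
lemma orientProb_exists_badSet_le {k : ℕ} {M : ℝ} (hM0 : 0 ≤ M)
    (hM : ∀ X : Finset (Fin n), X.card = k → X.Nonempty → 2 * vol G X ≤ vol G univ →
      4 ^ k * (2 / 3 : ℝ) ^ crossCount G X ≤ M) :
    orientProb G (fun f => ∃ X : Finset (Fin n), X.card = k ∧ BadSet G f X) ≤ 2 * n * M := by
  classical
  set F : Finset (Finset (Fin n)) := univ.filter fun X => X.card = k ∧
    (G.induce (X : Set (Fin n))).Connected ∧ 2 * vol G X ≤ vol G univ with hF
  have hFmem : ∀ X ∈ F, X.card = k ∧ (G.induce (X : Set (Fin n))).Connected ∧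
      2 * vol G X ≤ vol G univ := fun X hX => (mem_filter.mp hX).2
  have hsum := sum_connected_weight_le G (p := 1 / 4) (q := 3 / 4) (by norm_num) (by norm_num)
    (by norm_num) F fun X hX => (hFmem X hX).2.1
  have hMX : ∀ X ∈ F, 4 ^ k * (2 / 3 : ℝ) ^ crossCount G X ≤ M := by
    intro X hX
    obtain ⟨h1, h2, h3⟩ := hFmem X hX
    obtain ⟨v, hv⟩ := h2.nonempty
    exact hM X h1 ⟨v, hv⟩ h3
  calc orientProb G (fun f => ∃ X : Finset (Fin n), X.card = k ∧ BadSet G f X)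
      ≤ orientProb G (fun f => ∃ X ∈ F, NoEdgeIn G f X ∨ NoEdgeOut G f X) := by
        refine orientProb_mono G ?_
        rintro f ⟨X, hk, hc, hv, h⟩
        exact ⟨X, mem_filter.mpr ⟨mem_univ _, hk, hc, hv⟩, h⟩
    _ ≤ ∑ X ∈ F, orientProb G (fun f => NoEdgeIn G f X ∨ NoEdgeOut G f X) :=
        orientProb_exists_mem_le G F _
    _ ≤ ∑ X ∈ F, 2 * M * ((1 / 4) ^ X.card * (3 / 4) ^ (vertexBoundary G X).card) := by
        refine sum_le_sum fun X hX => ?_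
        calc _ ≤ _ := orientProb_or_le G _ _
          _ ≤ (1 / 2) ^ crossCount G X + (1 / 2) ^ crossCount G X :=
              add_le_add (orientProb_noEdgeIn_le G X) (orientProb_noEdgeOut_le G X)
          _ = 2 * (4 ^ k * (2 / 3 : ℝ) ^ crossCount G X) *
                ((1 / 4) ^ X.card * (3 / 4) ^ crossCount G X) := by
              rw [(hFmem X hX).1, show (1 / 2 : ℝ) = 2 / 3 * (3 / 4) by norm_num, mul_pow]
              have : (4 : ℝ) ^ k * (1 / 4) ^ k = 1 := by rw [← mul_pow]; norm_num
              linear_combination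
                (-2 * (2 / 3 : ℝ) ^ crossCount G X * (3 / 4) ^ crossCount G X) * this
          _ ≤ _ := by
              have h1 := hMX X hX
              have h2 : (3 / 4 : ℝ) ^ crossCount G X ≤ (3 / 4) ^ (vertexBoundary G X).card :=
                pow_le_pow_of_le_one (by norm_num) (by norm_num)
                  (card_vertexBoundary_le_crossCount G X)
              gcongr
    _ = 2 * M * ∑ X ∈ F, (1 / 4) ^ X.card * (3 / 4) ^ (vertexBoundary G X).card :=
        (mul_sum _ _ _).symm
    _ ≤ 2 * M * n := by gcongr
    _ = 2 * n * M := by ring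

lemma card_mul_le_vol {d : ℝ} (hd : ∀ v, d ≤ (G.degree v : ℝ)) (X : Finset (Fin n)) :
    X.card * d ≤ vol G X := by
  unfold vol
  push_cast
  rw [← nsmul_eq_mul]
  exact card_nsmul_le_sum _ _ _ fun v _ => hd v

lemma mul_card_le_crossCount {d φ : ℝ} (hd0 : 0 < d) (hφ : 0 ≤ φ)
    (hd : ∀ v, d ≤ (G.degree v : ℝ))
    (hG : ∀ X : Finset (Fin n), X.Nonempty → X ≠ univ →
      φ < (crossCount G X : ℝ) / min (vol G X : ℝ) (vol G Xᶜ : ℝ))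
    {X : Finset (Fin n)} (hX : X.Nonempty) (hvol : 2 * vol G X ≤ vol G univ) :
    φ * (X.card * d) ≤ crossCount G X := by
  have hadd : vol G X + vol G Xᶜ = vol G univ := sum_add_sum_compl X _
  have hXd := card_mul_le_vol G hd X
  have hcard : (0 : ℝ) < X.card := by exact_mod_cast hX.card_pos
  have hpos : (0 : ℝ) < vol G X := lt_of_lt_of_le (by positivity) hXd
  have hne : X ≠ univ := by
    rintro rfl
    have : 0 < vol G univ := by exact_mod_cast hpos
    omega
  have hmin : min (vol G X : ℝ) (vol G Xᶜ : ℝ) = vol G X :=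
    min_eq_left (by exact_mod_cast (by omega : vol G X ≤ vol G Xᶜ))
  have h := hG X hX hne
  rw [hmin, lt_div_iff₀ hpos] at h
  exact (mul_le_mul_of_nonneg_left hXd hφ).trans h.le

end Probability

lemma four_pow_mul_two_thirds_pow_le {L : ℝ} (hL : 4 ≤ L) {k c : ℕ}
    (hc : 4 * Real.logb 2 L * k ≤ c) : (4 : ℝ) ^ k * (2 / 3) ^ c ≤ L ^ (-(k : ℝ)) := by
  have hL0 : 0 < L := by linarith
  have hlog : 0 ≤ Real.logb 2 L := Real.logb_nonneg (by norm_num) (by linarith)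
  have h1 : (2 / 3 : ℝ) ^ c ≤ (L ^ (-(k : ℝ))) ^ 2 := by
    calc (2 / 3 : ℝ) ^ c = (2 / 3 : ℝ) ^ (c : ℝ) := (Real.rpow_natCast _ _).symm
      _ ≤ (2 / 3 : ℝ) ^ (4 * Real.logb 2 L * k) :=
          Real.rpow_le_rpow_of_exponent_ge (by norm_num) (by norm_num) hc
      _ = ((2 / 3 : ℝ) ^ (4 : ℝ)) ^ (Real.logb 2 L * k) := by
          rw [← Real.rpow_mul (by norm_num), mul_assoc]
      _ ≤ ((2 : ℝ) ^ (-2 : ℝ)) ^ (Real.logb 2 L * k) := by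
          refine Real.rpow_le_rpow (by positivity) ?_ (by positivity)
          rw [Real.rpow_neg (by norm_num)]
          norm_num
      _ = (((2 : ℝ) ^ Real.logb 2 L) ^ (-(k : ℝ))) ^ 2 := by
          rw [← Real.rpow_natCast, ← Real.rpow_mul (by norm_num), ← Real.rpow_mul (by positivity),
            ← Real.rpow_mul (by norm_num)]
          congr 1
          push_cast
          ring
      _ = (L ^ (-(k : ℝ))) ^ 2 := by rw [Real.rpow_logb (by norm_num) (by norm_num) hL0]
  have h2 : (4 : ℝ) ^ k * L ^ (-(k : ℝ)) ≤ 1 := by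
    rw [Real.rpow_neg hL0.le, Real.rpow_natCast, ← div_eq_mul_inv, div_le_one (by positivity)]
    gcongr
  have h3 : 0 < L ^ (-(k : ℝ)) := Real.rpow_pos_of_pos hL0 _
  calc (4 : ℝ) ^ k * (2 / 3) ^ c ≤ 4 ^ k * (L ^ (-(k : ℝ))) ^ 2 := by gcongr
    _ = (4 ^ k * L ^ (-(k : ℝ))) * L ^ (-(k : ℝ)) := by ring
    _ ≤ 1 * L ^ (-(k : ℝ)) := by gcongr
    _ = _ := one_mul _

lemma union_bound_le {α : ℝ} (hα : 0 < α) {n : ℕ} (hn : 1 ≤ n) (hαn : 4 * α ≤ n)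
    (hL : 4 ≤ Real.logb 2 n) (hLL : 4 + α ≤ α / 2 * Real.logb 2 (Real.logb 2 n)) :
    (n + 1) * (2 * n * Real.logb 2 n ^ (-(α / 2 * Real.logb 2 n))) ≤
      1 / (α * (n : ℝ) ^ α * Real.logb 2 n) := by
  set L := Real.logb 2 n with hLdef
  have hn1 : (1 : ℝ) ≤ n := by exact_mod_cast hn
  have hn0 : (0 : ℝ) < n := by linarith
  have hL0 : 0 < L := by linarith
  have hLn : L ≤ n := by
    rw [hLdef, Real.logb_le_iff_le_rpow (by norm_num) hn0, Real.rpow_natCast]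
    exact_mod_cast Nat.lt_two_pow_self.le
  have hpow : L ^ (-(α / 2 * L)) ≤ (n : ℝ) ^ (-(4 + α)) := by
    calc L ^ (-(α / 2 * L)) = ((2 : ℝ) ^ Real.logb 2 L) ^ (-(α / 2 * L)) := by
          rw [Real.rpow_logb (by norm_num) (by norm_num) hL0]
      _ = ((2 : ℝ) ^ L) ^ (-(α / 2 * Real.logb 2 L)) := by
          rw [← Real.rpow_mul (by norm_num), ← Real.rpow_mul (by norm_num)]
          congr 1
          ring
      _ = (n : ℝ) ^ (-(α / 2 * Real.logb 2 L)) := by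
          rw [hLdef, Real.rpow_logb (by norm_num) (by norm_num) hn0]
      _ ≤ (n : ℝ) ^ (-(4 + α)) := Real.rpow_le_rpow_of_exponent_le hn1 (by linarith)
  have hnα : 0 < (n : ℝ) ^ α := Real.rpow_pos_of_pos hn0 _
  have hsplit : (n : ℝ) ^ (-(4 + α)) * ((n : ℝ) ^ 4 * (n : ℝ) ^ α) = 1 := by
    rw [← Real.rpow_natCast, ← Real.rpow_add hn0, ← Real.rpow_add hn0]
    norm_num
  have hneg : 0 < (n : ℝ) ^ (-(4 + α)) := Real.rpow_pos_of_pos hn0 _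
  rw [le_div_iff₀ (by positivity)]
  calc (n + 1) * (2 * n * L ^ (-(α / 2 * L))) * (α * (n : ℝ) ^ α * L)
      ≤ (n + n) * (2 * n * (n : ℝ) ^ (-(4 + α))) * (α * (n : ℝ) ^ α * n) := by gcongr
    _ = (4 * α) * ((n : ℝ) ^ 3 * (n : ℝ) ^ α * (n : ℝ) ^ (-(4 + α))) := by ring
    _ ≤ n * ((n : ℝ) ^ 3 * (n : ℝ) ^ α * (n : ℝ) ^ (-(4 + α))) := by gcongr
    _ = (n : ℝ) ^ (-(4 + α)) * ((n : ℝ) ^ 4 * (n : ℝ) ^ α) := by ring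
    _ = 1 := hsplit

/-- **Regime 2.** Under the hypotheses of Theorem 1.1, the sum over
`(α/2)·log₂ n ≤ k ≤ n` of the probabilities `P(B_k)` that some `k`-vertex set is bad
is at most `1/(α·n^α·log₂ n)`. -/
theorem large_bad_sets_unlikely (α ξ : ℝ) (hα : 0 < α) (hξ : 4 < ξ) :
    ∃ N₀ : ℕ, ∀ n : ℕ, N₀ ≤ n → ∀ (G : SimpleGraph (Fin n)) [DecidableRel G.Adj],
      (∀ v : Fin n, (1 + α) * Real.logb 2 n ≤ (G.degree v : ℝ)) →
      (∀ X : Finset (Fin n), X.Nonempty → X ≠ Finset.univ →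
        ξ * (Real.logb 2 (Real.logb 2 n) / Real.logb 2 n) <
          (crossCount G X : ℝ) / min ((vol G X : ℝ)) ((vol G Xᶜ : ℝ))) →
      ∑ k ∈ (Finset.range (n + 1)).filter
          (fun k : ℕ => α / 2 * Real.logb 2 n ≤ (k : ℝ)),
        orientProb G (fun f => ∃ X : Finset (Fin n), X.card = k ∧ BadSet G f X) ≤
      1 / (α * (n : ℝ) ^ α * Real.logb 2 n) := by
  have hlog : Filter.Tendsto (fun n : ℕ => Real.logb 2 (n : ℝ)) Filter.atTop Filter.atTop :=
    (Real.tendsto_logb_atTop (by norm_num)).comp tendsto_natCast_atTop_atTop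
  have hloglog : Filter.Tendsto (fun n : ℕ => α / 2 * Real.logb 2 (Real.logb 2 (n : ℝ)))
      Filter.atTop Filter.atTop :=
    ((Real.tendsto_logb_atTop (by norm_num)).comp hlog).const_mul_atTop (by positivity)
  obtain ⟨N₀, hN₀⟩ := Filter.eventually_atTop.mp
    ((Filter.eventually_ge_atTop 1).and <|
      (tendsto_natCast_atTop_atTop.eventually_ge_atTop (4 * α)).and <|
      (hlog.eventually_ge_atTop 4).and (hloglog.eventually_ge_atTop (4 + α)))
  refine ⟨N₀, fun n hn G _ hdeg hcheeger => ?_⟩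
  obtain ⟨hn1, hαn, hL, hLL⟩ := hN₀ n hn
  refine le_trans ?_ (union_bound_le hα hn1 hαn hL hLL)
  set L := Real.logb 2 n
  have hL0 : 0 < L := by linarith
  have hlogL : 0 ≤ Real.logb 2 L := Real.logb_nonneg (by norm_num) (by linarith)
  have hterm : ∀ k ∈ (range (n + 1)).filter (fun k : ℕ => α / 2 * L ≤ (k : ℝ)),
      orientProb G (fun f => ∃ X : Finset (Fin n), X.card = k ∧ BadSet G f X) ≤
        2 * n * L ^ (-(α / 2 * L)) := by
    intro k hk
    refine orientProb_exists_badSet_le G (by positivity) fun X hXk hX hvol => ?_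
    refine (four_pow_mul_two_thirds_pow_le hL ?_).trans
      (Real.rpow_le_rpow_of_exponent_le (by linarith) (neg_le_neg (mem_filter.mp hk).2))
    refine le_trans ?_
      (mul_card_le_crossCount G (by positivity) (by positivity) hdeg hcheeger hX hvol)
    rw [hXk]
    calc 4 * Real.logb 2 L * k ≤ ξ * Real.logb 2 L * k * (1 + α) := by
          have : 4 * (Real.logb 2 L * k) ≤ ξ * (Real.logb 2 L * k) := by gcongr
          nlinarith [mul_nonneg (mul_nonneg (by linarith : 0 ≤ ξ)
            (mul_nonneg hlogL (Nat.cast_nonneg (α := ℝ) k))) hα.le]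
      _ = ξ * (Real.logb 2 L / L) * (k * ((1 + α) * L)) := by
          field_simp
  calc _ ≤ _ := sum_le_card_nsmul _ _ _ hterm
    _ ≤ (n + 1) * (2 * n * L ^ (-(α / 2 * L))) := by
        rw [nsmul_eq_mul]
        gcongr
        exact_mod_cast (card_filter_le _ _).trans (card_range _).le
end

section
/- Let k ≥ 2 and let π = (π_1, …, π_{k−1}) be an exposure sequence of length k−1. Then p(π) + ℓ(π) ≥ k/2. -/
open Finset

/-- `π : Fin (k-1) → ℕ` (representing `(π_1, …, π_{k−1})`) is an exposure sequence:
every initial partial sum `π_1 + ⋯ + π_{j+1}` is at least `j+1`, and the total sum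
is `k − 1`. -/
def IsExposureSeq (k : ℕ) (π : Fin (k - 1) → ℕ) : Prop :=
  (∀ j : Fin (k - 1), (j : ℕ) + 1 ≤ ∑ i ∈ Finset.univ.filter (fun i => i ≤ j), π i) ∧
    ∑ i, π i = k - 1

/-- `ℓ(π)`: one plus the number of zero entries of `π` (the number of leaves of the
corresponding rooted tree). -/
def leafCount (k : ℕ) (π : Fin (k - 1) → ℕ) : ℕ :=
  1 + (Finset.univ.filter (fun j => π j = 0)).card

/-- `p(π)`: the number of entries of `π` equal to `1`. -/
def oneCount (k : ℕ) (π : Fin (k - 1) → ℕ) : ℕ :=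
  (Finset.univ.filter (fun j => π j = 1)).card

/-- **Lemma 4.3, first part.** For any exposure sequence `π` of length `k−1`,
`p(π) + ℓ(π) ≥ k/2`. -/
theorem exposure_ones_add_leaves (k : ℕ) (hk : 2 ≤ k) (π : Fin (k - 1) → ℕ)
    (hπ : IsExposureSeq k π) :
    k ≤ 2 * (oneCount k π + leafCount k π) := by
  have pointwise : ∀ j ∈ (Finset.univ : Finset (Fin (k - 1))),
      2 ≤ π j + 2 * (if π j = 0 then 1 else 0) + (if π j = 1 then 1 else 0) := by
    intro j _
    split_ifs <;> omega
  have total := Finset.sum_le_sum pointwise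
  rw [Finset.sum_add_distrib, Finset.sum_add_distrib, ← Finset.mul_sum,
    ← Finset.card_filter, ← Finset.card_filter, hπ.2, Finset.sum_const,
    Finset.card_univ, Fintype.card_fin, smul_eq_mul] at total
  unfold oneCount leafCount
  omega
end

section
/- For every real Φ with 0 < Φ ≤ 1 and all natural numbers s and t, C(s,t)·2^{−Φ·s} ≤ (2/Φ)^t, where C(s,t) denotes the binomial coefficient s choose t. -/
theorem choose_mul_pow_le_one_add_pow {x : ℝ} (hx : 0 ≤ x) (s t : ℕ) :
    (s.choose t : ℝ) * x ^ t ≤ (1 + x) ^ s := by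
  rcases lt_or_ge s t with h | h
  · rw [Nat.choose_eq_zero_of_lt h, Nat.cast_zero, zero_mul]
    positivity
  · rw [add_comm, add_pow]
    have := Finset.single_le_sum (f := fun m ↦ x ^ m * 1 ^ (s - m) * (s.choose m : ℝ))
      (fun _ _ ↦ by positivity) (Finset.mem_range.mpr (Nat.lt_succ_of_le h))
    simpa [mul_comm] using this

theorem one_add_half_le_two_rpow {x : ℝ} (hx : 0 ≤ x) : 1 + x / 2 ≤ (2 : ℝ) ^ x := by
  rw [Real.rpow_def_of_pos two_pos]
  nlinarith [Real.add_one_le_exp (Real.log 2 * x), Real.log_two_gt_d9]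

/-- For `0 < Φ ≤ 1` and all naturals `s, t`: `C(s,t)·2^{−Φs} ≤ (2/Φ)^t`. -/
theorem choose_mul_two_rpow_le (Φ : ℝ) (hΦ0 : 0 < Φ) (hΦ1 : Φ ≤ 1) (s t : ℕ) :
    (s.choose t : ℝ) * (2 : ℝ) ^ (-(Φ * s)) ≤ (2 / Φ) ^ t := by
  have h : (s.choose t : ℝ) * (Φ / 2) ^ t ≤ (2 : ℝ) ^ (Φ * s) := by
    rw [Real.rpow_mul two_pos.le, Real.rpow_natCast]
    exact (choose_mul_pow_le_one_add_pow (by positivity) s t).trans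
      (pow_le_pow_left₀ (by positivity) (one_add_half_le_two_rpow hΦ0.le) s)
  rw [Real.rpow_neg two_pos.le, ← div_eq_mul_inv, div_le_iff₀ (by positivity),
    ← inv_div, inv_pow, ← div_eq_inv_mul, le_div_iff₀ (by positivity)]
  exact h
end

section
/- Let G be a finite simple graph on N vertices with maximum degree at most d, and let k ≥ 1 be an integer. Then the number of independent sets of size k in G is at least (1/k!)·∏_{i=0}^{k−1} (N − i·(d+1)); in particular, when N ≥ k·(d+1) this number is at least (N − k·(d+1))^k / k!. -/
open Finset

/-- Double counting of the pairs of independent sets `s ⊆ t` with `#s = k` and `#t = k + 1`. -/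
lemma card_independent_mul_le {V : Type*} [Fintype V] [DecidableEq V] (G : SimpleGraph V)
    [DecidableRel G.Adj] (d : ℕ) (hd : ∀ v, G.degree v ≤ d) (k : ℕ) :
    ((univ.powersetCard k).filter
        (fun s : Finset V => ∀ u ∈ s, ∀ v ∈ s, ¬ G.Adj u v)).card *
        (Fintype.card V - k * (d + 1)) ≤
      ((univ.powersetCard (k + 1)).filter
        (fun s : Finset V => ∀ u ∈ s, ∀ v ∈ s, ¬ G.Adj u v)).card * (k + 1) := by
  refine card_mul_le_card_mul (fun s t : Finset V => s ⊆ t) (fun s hs => ?_) (fun t ht => ?_)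
  · simp only [mem_filter, mem_powersetCard, subset_univ, true_and] at hs
    obtain ⟨hsk, hs⟩ := hs
    set U := s.biUnion fun v => insert v (G.neighborFinset v) with hU
    have hUcard : #U ≤ k * (d + 1) := by
      rw [← hsk]
      refine card_biUnion_le_card_mul _ _ _ fun v _ => (card_insert_le _ _).trans ?_
      simpa using hd v
    have hmem : ∀ v ∈ Uᶜ, v ∉ s ∧ ∀ u ∈ s, ¬ G.Adj u v := by
      intro v hv
      simp only [hU, mem_compl, mem_biUnion, mem_insert, SimpleGraph.mem_neighborFinset,
        not_exists, not_and, not_or] at hv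
      exact ⟨fun h => (hv v h).1 rfl, fun u hu => (hv u hu).2⟩
    calc Fintype.card V - k * (d + 1) ≤ #Uᶜ := by rw [card_compl]; omega
      _ ≤ _ := by
        refine card_le_card_of_injOn (fun v => insert v s) (fun v hv => ?_)
          fun v hv w hw h => ?_
        · obtain ⟨hvs, hadj⟩ := hmem v hv
          simp only [mem_coe, mem_bipartiteAbove, mem_filter, mem_powersetCard, subset_univ,
            true_and, card_insert_of_notMem hvs, hsk, subset_insert, and_true]
          intro a ha b hb
          rcases mem_insert.1 ha with rfl | has <;> rcases mem_insert.1 hb with rfl | hbs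
          · exact G.irrefl
          · exact fun h => hadj b hbs h.symm
          · exact hadj a has
          · exact hs a has b hbs
        · have hv' : v ∈ insert w s := by
            rw [← show insert v s = insert w s from h]
            exact mem_insert_self v s
          exact (mem_insert.1 hv').resolve_right (hmem v hv).1
  · simp only [mem_filter, mem_powersetCard, subset_univ, true_and] at ht
    calc _ ≤ #(t.powersetCard k) := by
          refine card_le_card fun s hs => ?_
          simp only [mem_bipartiteBelow, mem_filter, mem_powersetCard, subset_univ,
            true_and] at hs
          exact mem_powersetCard.2 ⟨hs.2, hs.1.1⟩
      _ = k + 1 := by rw [card_powersetCard, ht.1, Nat.choose_succ_self_right]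

/-- A greedy lower bound for the number of ordered independent `k`-tuples. -/
lemma prod_le_factorial_mul_card_independent {V : Type*} [Fintype V] [DecidableEq V]
    (G : SimpleGraph V) [DecidableRel G.Adj] (d : ℕ) (hd : ∀ v, G.degree v ≤ d) (k : ℕ) :
    ∏ i ∈ range k, (Fintype.card V - i * (d + 1)) ≤
      k.factorial * ((univ.powersetCard k).filter
        (fun s : Finset V => ∀ u ∈ s, ∀ v ∈ s, ¬ G.Adj u v)).card := by
  induction k with
  | zero => simp [filter_singleton]
  | succ k ih =>
    rw [prod_range_succ]
    refine (Nat.mul_le_mul_right _ ih).trans ?_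
    rw [mul_assoc, Nat.factorial_succ, mul_comm (k + 1), mul_assoc, mul_comm (k + 1)]
    exact Nat.mul_le_mul_left _ (card_independent_mul_le G d hd k)

/-- If `G` is a graph on `N` vertices with maximum degree at most `d`, then for `k ≥ 1`
the number of independent sets of `k` vertices is at least `(1/k!)·∏_{i<k} (N − i(d+1))`;
in particular, if `N ≥ k(d+1)` it is at least `(N − k(d+1))^k / k!`. -/
theorem independent_sets_lower_bound {N : ℕ} (G : SimpleGraph (Fin N)) [DecidableRel G.Adj]
    (d : ℕ) (hd : ∀ v : Fin N, G.degree v ≤ d) (k : ℕ) (hk : 1 ≤ k) :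
    (∏ i ∈ Finset.range k, (N - i * (d + 1)) ≤
      k.factorial * ((Finset.univ.powersetCard k).filter
        (fun s : Finset (Fin N) => ∀ u ∈ s, ∀ v ∈ s, ¬ G.Adj u v)).card) ∧
    (k * (d + 1) ≤ N →
      (N - k * (d + 1)) ^ k ≤
        k.factorial * ((Finset.univ.powersetCard k).filter
          (fun s : Finset (Fin N) => ∀ u ∈ s, ∀ v ∈ s, ¬ G.Adj u v)).card) := by
  have key := prod_le_factorial_mul_card_independent G d hd k
  rw [Fintype.card_fin] at key
  refine ⟨by convert key, fun _ => Nat.le_trans ?_ (by convert key)⟩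
  calc (N - k * (d + 1)) ^ k = ∏ _i ∈ range k, (N - k * (d + 1)) := by simp
    _ ≤ _ := prod_le_prod' fun i hi =>
      Nat.sub_le_sub_left (Nat.mul_le_mul_right _ (mem_range.1 hi).le) N
end
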